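/- Comparison principle when the infimum representation holds only for large momenta: let A satisfy (A1)–(A2), let H ∈ ℋ(m, Λ, (a_r), (M_r)), and assume there exists ρ > 0 such that H(x,p) = inf_{i∈I} H_i(x,p) for all x ∈ ℝ^d and all p with |p| ≥ ρ, where each H_i ∈ 𝔅(m_i, Λ, (a_r), (M_r)) with m_i > 1. Then for every open U ⊆ ℝ^d, every upper semicontinuous viscosity subsolution v on [0,T]×cl(U) and every lower semicontinuous viscosity supersolution w on [0,T]×cl(U) of ∂_t u − tr(A(x) D_x² u) + H(x, D_x u) = 0 in (0,T)×U satisfying the sublinear growth condition, one has v(t,x) − w(t,x) ≤ sup_{∂_P((0,T)×U)} (v − w) for every (t,x) ∈ (0,T)×U. -/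

import Mathlib

open Set Metric Filter
open scoped ENNReal NNReal RealInnerProductSpace

noncomputable section

abbrev Euc (d : ℕ) := EuclideanSpace ℝ (Fin d)

/-- Time partial derivative `∂_t u (t,x)`. -/
def timeDeriv (d : ℕ) (u : ℝ × Euc d → ℝ) (t : ℝ) (x : Euc d) : ℝ :=
  deriv (fun s => u (s, x)) t

/-- Spatial partial derivative `∂_{x_i} u (t,x)`. -/
def spacePartial (d : ℕ) (i : Fin d) (u : ℝ × Euc d → ℝ) (t : ℝ) (x : Euc d) : ℝ :=
  fderiv ℝ (fun y => u (t, y)) x (EuclideanSpace.single i 1)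

/-- Spatial gradient `D_x u (t,x)`. -/
def spaceGrad (d : ℕ) (u : ℝ × Euc d → ℝ) (t : ℝ) (x : Euc d) : Euc d :=
  (EuclideanSpace.equiv (Fin d) ℝ).symm (fun i => spacePartial d i u t x)

/-- Spatial Hessian matrix `D_x² u (t,x)`. -/
def spaceHessian (d : ℕ) (u : ℝ × Euc d → ℝ) (t : ℝ) (x : Euc d) :
    Matrix (Fin d) (Fin d) ℝ :=
  Matrix.of fun i j => spacePartial d i (fun p => spacePartial d j u p.1 p.2) t x

/-- The quasilinear parabolic operator `∂_t u - tr(A(x) D_x² u) + H(x, D_x u)`. -/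
def parabolicOp (d : ℕ) (A : Euc d → Matrix (Fin d) (Fin d) ℝ) (H : Euc d → Euc d → ℝ)
    (u : ℝ × Euc d → ℝ) (t : ℝ) (x : Euc d) : ℝ :=
  timeDeriv d u t x - Matrix.trace (A x * spaceHessian d u t x) + H x (spaceGrad d u t x)

/-- Viscosity subsolution of `∂_t u - tr(A(x) D_x² u) + H(x, D_x u) = 0` in `(0,T) × U`. -/
def IsViscSubsolution (d : ℕ) (A : Euc d → Matrix (Fin d) (Fin d) ℝ)
    (H : Euc d → Euc d → ℝ) (T : ℝ) (U : Set (Euc d)) (v : ℝ × Euc d → ℝ) : Prop :=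
  ∀ φ : ℝ × Euc d → ℝ, ContDiff ℝ 2 φ → ∀ t₀ ∈ Ioo (0 : ℝ) T, ∀ x₀ ∈ U,
    IsLocalMaxOn (fun p => v p - φ p) (Ioo 0 T ×ˢ U) (t₀, x₀) →
    parabolicOp d A H φ t₀ x₀ ≤ 0

/-- Viscosity supersolution of `∂_t u - tr(A(x) D_x² u) + H(x, D_x u) = 0` in `(0,T) × U`. -/
def IsViscSupersolution (d : ℕ) (A : Euc d → Matrix (Fin d) (Fin d) ℝ)
    (H : Euc d → Euc d → ℝ) (T : ℝ) (U : Set (Euc d)) (w : ℝ × Euc d → ℝ) : Prop :=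
  ∀ φ : ℝ × Euc d → ℝ, ContDiff ℝ 2 φ → ∀ t₀ ∈ Ioo (0 : ℝ) T, ∀ x₀ ∈ U,
    IsLocalMinOn (fun p => w p - φ p) (Ioo 0 T ×ˢ U) (t₀, x₀) →
    0 ≤ parabolicOp d A H φ t₀ x₀

/-- Frobenius norm of a real matrix. -/
def matFrobNorm {k l : ℕ} (Mm : Matrix (Fin k) (Fin l) ℝ) : ℝ :=
  Real.sqrt (∑ i, ∑ j, (Mm i j) ^ 2)

/-- Conditions (A1)–(A2): `A = σ σᵀ` with `σ` bounded and Lipschitz with constant `Λ_A`. -/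
def CondA (d : ℕ) (ΛA : ℝ) (A : Euc d → Matrix (Fin d) (Fin d) ℝ) : Prop :=
  ∃ n : ℕ, ∃ σ : Euc d → Matrix (Fin d) (Fin n) ℝ,
    (∀ x, A x = σ x * (σ x).transpose) ∧
    (∀ x, matFrobNorm (σ x) ≤ ΛA) ∧
    (∀ x y, matFrobNorm (σ x - σ y) ≤ ΛA * ‖x - y‖)

/-- Condition (A3): entries of `A` are `C¹`. -/
def CondA3 (d : ℕ) (A : Euc d → Matrix (Fin d) (Fin d) ℝ) : Prop :=
  ∀ i j, ContDiff ℝ 1 (fun x : Euc d => A x i j)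

/-- Condition (A4): uniform ellipticity `⟨A(x)ξ, ξ⟩ ≥ λ|ξ|²`. -/
def CondA4 (d : ℕ) (lam : ℝ) (A : Euc d → Matrix (Fin d) (Fin d) ℝ) : Prop :=
  ∀ x ξ : Euc d, lam * ‖ξ‖ ^ 2 ≤ ∑ i, ∑ j, A x i j * ξ j * ξ i

/-- Condition (H3). -/
def CondH3 (d : ℕ) (m Λ : ℝ) (H : Euc d → Euc d → ℝ) : Prop :=
  ∀ x p q : Euc d, |H x p - H x q| ≤ Λ * (‖p‖ + ‖q‖ + 1) ^ (m - 1) * ‖p - q‖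

/-- Condition (H4) with parameter `μ`. -/
def CondH4 (d : ℕ) (m Λ μ : ℝ) (a M : ℝ → ℝ) (H : Euc d → Euc d → ℝ) : Prop :=
  ∀ r : ℝ, 0 < r →
    (a r ∈ Ioc (0 : ℝ) 1 ∧ 1 ≤ M r) ∧
    (∀ x ∈ ball (0 : Euc d) r, ∀ p : Euc d,
      max (-μ) (a r * ‖p‖ ^ m - M r) ≤ H x p ∧ H x p ≤ Λ * (‖p‖ ^ m + 1)) ∧
    (∀ x ∈ ball (0 : Euc d) r, ∀ y ∈ ball (0 : Euc d) r, ∀ p : Euc d,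
      |H x p - H y p| ≤ (Λ * ‖p‖ ^ m + M r) * ‖x - y‖)

/-- Condition (H4) with `μ = +∞`. -/
def CondH4top (d : ℕ) (m Λ : ℝ) (a M : ℝ → ℝ) (H : Euc d → Euc d → ℝ) : Prop :=
  ∀ r : ℝ, 0 < r →
    (a r ∈ Ioc (0 : ℝ) 1 ∧ 1 ≤ M r) ∧
    (∀ x ∈ ball (0 : Euc d) r, ∀ p : Euc d,
      a r * ‖p‖ ^ m - M r ≤ H x p ∧ H x p ≤ Λ * (‖p‖ ^ m + 1)) ∧
    (∀ x ∈ ball (0 : Euc d) r, ∀ y ∈ ball (0 : Euc d) r, ∀ p : Euc d,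
      |H x p - H y p| ≤ (Λ * ‖p‖ ^ m + M r) * ‖x - y‖)

/-- `limsup_{|x|→∞, x∈U} sup_{t∈[0,T]} v(t,x)/(1+|x|) ≤ 0`. -/
def SublinearAbove (d : ℕ) (T : ℝ) (U : Set (Euc d)) (v : ℝ × Euc d → ℝ) : Prop :=
  ∀ ε : ℝ, 0 < ε → ∃ R : ℝ, ∀ x ∈ U, R ≤ ‖x‖ → ∀ t ∈ Icc (0 : ℝ) T, v (t, x) ≤ ε * (1 + ‖x‖)

/-- `liminf_{|x|→∞, x∈U} inf_{t∈[0,T]} w(t,x)/(1+|x|) ≥ 0`. -/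
def SublinearBelow (d : ℕ) (T : ℝ) (U : Set (Euc d)) (w : ℝ × Euc d → ℝ) : Prop :=
  ∀ ε : ℝ, 0 < ε → ∃ R : ℝ, ∀ x ∈ U, R ≤ ‖x‖ → ∀ t ∈ Icc (0 : ℝ) T, -(ε * (1 + ‖x‖)) ≤ w (t, x)

/-- Parabolic boundary `({0} × U) ∪ ([0,T) × ∂U)`. -/
def parabolicBoundary (d : ℕ) (T : ℝ) (U : Set (Euc d)) : Set (ℝ × Euc d) :=
  ({0} ×ˢ U) ∪ (Ico 0 T ×ˢ frontier U)

/-- The families `(a_r)_{r>0} ⊆ (0,1]` and `(M_r)_{r>0} ⊆ [1,+∞)`. -/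
def GoodFamilies (a M : ℝ → ℝ) : Prop :=
  ∀ r : ℝ, 0 < r → a r ∈ Ioc (0 : ℝ) 1 ∧ 1 ≤ M r

/-- The class `𝔅(m, Λ, (a_r), (M_r))`: Borel functions `F(x,p)`, convex in `p`,
satisfying (H3) and the growth condition `a_r|p|^m - M_r ≤ F(x,p) ≤ Λ(|p|^m + 1)`
for `x ∈ B_r`. -/
def MemB (d : ℕ) (m Λ : ℝ) (a M : ℝ → ℝ) (F : Euc d → Euc d → ℝ) : Prop :=
  Measurable (fun q : Euc d × Euc d => F q.1 q.2) ∧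
  (∀ x : Euc d, ConvexOn ℝ univ (F x)) ∧
  (∀ x p q : Euc d, |F x p - F x q| ≤ Λ * (‖p‖ + ‖q‖ + 1) ^ (m - 1) * ‖p - q‖) ∧
  (∀ r : ℝ, 0 < r → ∀ x ∈ ball (0 : Euc d) r, ∀ p : Euc d,
    a r * ‖p‖ ^ m - M r ≤ F x p ∧ F x p ≤ Λ * (‖p‖ ^ m + 1))

/-- The class `ℋ(m, Λ, (a_r), (M_r))`: Hamiltonians satisfying (H3) and (H4) with
`μ = +∞`. -/
def MemH (d : ℕ) (m Λ : ℝ) (a M : ℝ → ℝ) (H : Euc d → Euc d → ℝ) : Prop :=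
  (∀ x p q : Euc d, |H x p - H x q| ≤ Λ * (‖p‖ + ‖q‖ + 1) ^ (m - 1) * ‖p - q‖) ∧
  (∀ r : ℝ, 0 < r →
    (∀ x ∈ ball (0 : Euc d) r, ∀ p : Euc d,
      a r * ‖p‖ ^ m - M r ≤ H x p ∧ H x p ≤ Λ * (‖p‖ ^ m + 1)) ∧
    (∀ x ∈ ball (0 : Euc d) r, ∀ y ∈ ball (0 : Euc d) r, ∀ p : Euc d,
      |H x p - H y p| ≤ (Λ * ‖p‖ ^ m + M r) * ‖x - y‖))

section Jensen

open Topology MeasureTheory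

variable {E : Type*} [NormedAddCommGroup E] [InnerProductSpace ℝ E] 

/-- contact points: a gradient bound from below is forced to agree with the contact slope -/
lemma contact_lower (f : E → ℝ) (C : ℝ)
    (hsc : ∀ x, ∃ g : E, ∀ y, f x + ⟪g, y - x⟫ - C * ‖y - x‖ ^ 2 ≤ f y)
    (x p : E) (hp : ∀ y, f y ≤ f x + ⟪p, y - x⟫) :
    ∀ y, f x + ⟪p, y - x⟫ - C * ‖y - x‖ ^ 2 ≤ f y := by
  obtain ⟨g, hg⟩ := hsc x
  have key : ∀ s : ℝ, 0 < s → ‖g - p‖ ^ 2 ≤ C * s * ‖g - p‖ ^ 2 := by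
    intro s hs
    have h1 := hg (x + s • (g - p))
    have h2 := hp (x + s • (g - p))
    simp only [add_sub_cancel_left, inner_smul_right, norm_smul, Real.norm_eq_abs, abs_of_pos hs]
      at h1 h2
    have h3 : ⟪g, g - p⟫ - ⟪p, g - p⟫ = ‖g - p‖ ^ 2 := by
      rw [← inner_sub_left, real_inner_self_eq_norm_sq]
    have h4 : s * (‖g - p‖ ^ 2) ≤ s * (C * s * ‖g - p‖ ^ 2) := by
      nlinarith
    exact le_of_mul_le_mul_left h4 hs
  have hgp : g = p := by
    by_contra hne
    have hpos : 0 < ‖g - p‖ ^ 2 := by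
      have := norm_pos_iff.2 (sub_ne_zero.2 hne)
      positivity
    have h1 := key (1 / (2 * (|C| + 1))) (by positivity)
    have h2 : C * (1 / (2 * (|C| + 1))) ≤ 1 / 2 := by
      rw [mul_one_div, div_le_iff₀ (by positivity)]
      nlinarith [le_abs_self C, abs_nonneg C]
    nlinarith
  rw [← hgp]
  exact hg

lemma contact_lip (f : E → ℝ) (C : ℝ) (hC : 0 ≤ C)
    (x p x' p' : E) (hp : ∀ y, f y ≤ f x + ⟪p, y - x⟫)
    (hl : ∀ y, f x + ⟪p, y - x⟫ - C * ‖y - x‖ ^ 2 ≤ f y)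
    (hl' : ∀ y, f x' + ⟪p', y - x'⟫ - C * ‖y - x'‖ ^ 2 ≤ f y) :
    ‖p - p'‖ ≤ (2 * C) * ‖x - x'‖ := by
  by_cases h0 : p = p'
  · subst h0; simp; positivity
  have hn : 0 < ‖p - p'‖ := norm_pos_iff.2 (sub_ne_zero.2 h0)
  by_cases hx : x = x'
  · subst hx
    exfalso
    -- slopes agree
    have key : ∀ s : ℝ, 0 < s → ‖p - p'‖ ^ 2 ≤ C * s * ‖p - p'‖ ^ 2 := by
      intro s hs
      have h1 := hl' (x - s • (p - p'))
      have h2 := hp (x - s • (p - p'))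
      have e : x - s • (p - p') - x = - (s • (p - p')) := by abel
      rw [e] at h1 h2
      simp only [norm_neg, inner_neg_right, inner_smul_right, norm_smul, Real.norm_eq_abs,
        abs_of_pos hs] at h1 h2
      have h3 : ⟪p, p - p'⟫ - ⟪p', p - p'⟫ = ‖p - p'‖ ^ 2 := by
        rw [← inner_sub_left, real_inner_self_eq_norm_sq]
      have h4 : s * (‖p - p'‖ ^ 2) ≤ s * (C * s * ‖p - p'‖ ^ 2) := by nlinarith
      exact le_of_mul_le_mul_left h4 hs
    have h1 := key (1 / (2 * (|C| + 1))) (by positivity)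
    have h2 : C * (1 / (2 * (|C| + 1))) ≤ 1 / 2 := by
      rw [mul_one_div, div_le_iff₀ (by positivity)]
      nlinarith [le_abs_self C, abs_nonneg C]
    nlinarith [pow_pos hn 2]
  have hs : 0 < ‖x - x'‖ := norm_pos_iff.2 (sub_ne_zero.2 hx)
  set s := ‖x - x'‖ with hsdef
  set u : E := (s / ‖p - p'‖) • (p - p') with hu
  have hun : ‖u‖ = s := by
    rw [hu, norm_smul, Real.norm_eq_abs, abs_of_pos (by positivity)]
    field_simp
  have h1 := hp (x' - u)
  have h2 := hl' (x' - u)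
  have h3 := hl x'
  have e1 : x' - u - x' = -u := by abel
  have e2 : x' - u - x = (x' - x) - u := by abel
  have e3 : ‖x' - x‖ = s := by rw [hsdef, norm_sub_rev]
  rw [e1, norm_neg, inner_neg_right, hun] at h2
  rw [e2, inner_sub_right] at h1
  rw [e3] at h3
  have h4 : ⟪p, u⟫ - ⟪p', u⟫ = s * ‖p - p'‖ := by
    rw [← inner_sub_left, hu, inner_smul_right, real_inner_self_eq_norm_sq]
    field_simp
  have h5 : s * ‖p - p'‖ ≤ s * (2 * C * s) := by nlinarith
  exact le_of_mul_le_mul_left h5 hs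

end Jensen

section Jensen2

open Topology MeasureTheory

variable {E : Type*} [NormedAddCommGroup E] [InnerProductSpace ℝ E] 

lemma density_near [FiniteDimensional ℝ E] [MeasurableSpace E] [BorelSpace E]
    (μ : Measure E) [μ.IsAddHaarMeasure] (K : Set E) (x : E) (hx : x ∈ K)
    (hd : Tendsto (fun r => μ (K ∩ closedBall x r) / μ (closedBall x r)) (𝓝[>] 0) (𝓝 1))
    (τ : ℝ) (hτ : 0 < τ) :
    ∃ r > 0, ∀ y, ‖y - x‖ < r → ∃ y' ∈ K, ‖y - y'‖ ≤ τ * ‖y - x‖ := by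
  set n := Module.finrank ℝ E with hn
  set Q : ℝ := (τ / (1 + τ)) ^ n with hQ
  have hQpos : 0 < Q := by positivity
  have hlt : (1 : ℝ≥0∞) - ENNReal.ofReal Q < 1 :=
    ENNReal.sub_lt_self ENNReal.one_ne_top one_ne_zero (by simpa using hQpos)
  have hev := hd.eventually (lt_mem_nhds hlt)
  rw [eventually_nhdsWithin_iff, Metric.eventually_nhds_iff] at hev
  obtain ⟨r, hr, hev⟩ := hev
  refine ⟨r / (1 + τ), by positivity, fun y hy => ?_⟩
  by_cases hyx : y = x
  · exact ⟨x, hx, by simp [hyx]⟩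
  have hρ : 0 < ‖y - x‖ := norm_pos_iff.2 (sub_ne_zero.2 hyx)
  by_contra! hcon
  set R := (1 + τ) * ‖y - x‖ with hR
  have hRpos : 0 < R := by positivity
  have hRr : R < r := by
    rw [lt_div_iff₀ (by positivity)] at hy
    rw [hR]; linarith
  have h1 := hev (y := R) (by rw [Real.dist_eq, sub_zero, abs_of_pos hRpos]; exact hRr) hRpos
  have hsub : closedBall y (τ * ‖y - x‖) ⊆ closedBall x R := by
    apply closedBall_subset_closedBall'
    rw [dist_eq_norm, hR]; linarith
  have hdis : Disjoint (K ∩ closedBall x R) (closedBall y (τ * ‖y - x‖)) := by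
    rw [Set.disjoint_left]
    rintro z ⟨hz, -⟩ hz2
    have := hcon z hz
    rw [mem_closedBall, dist_eq_norm, norm_sub_rev] at hz2
    linarith
  have h2 : μ (K ∩ closedBall x R) + μ (closedBall y (τ * ‖y - x‖)) ≤ μ (closedBall x R) := by
    rw [← measure_union hdis measurableSet_closedBall]
    exact measure_mono (union_subset inter_subset_right hsub)
  have h3 : μ (closedBall y (τ * ‖y - x‖)) = ENNReal.ofReal Q * μ (closedBall x R) := by
    rw [Measure.addHaar_closedBall _ _ (by positivity), Measure.addHaar_closedBall _ _ hRpos.le,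
      ← mul_assoc, ← ENNReal.ofReal_mul hQpos.le]
    congr 2
    rw [hQ, hR, ← mul_pow]
    congr 1
    field_simp
  have hm0 : μ (closedBall x R) ≠ 0 := (measure_closedBall_pos μ x hRpos).ne'
  have hmt : μ (closedBall x R) ≠ ⊤ := measure_closedBall_lt_top.ne
  have h4 : μ (K ∩ closedBall x R) / μ (closedBall x R) + ENNReal.ofReal Q ≤ 1 := by
    have : (μ (K ∩ closedBall x R) + ENNReal.ofReal Q * μ (closedBall x R)) / μ (closedBall x R)
        ≤ 1 := by
      apply ENNReal.div_le_of_le_mul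
      rw [one_mul, ← h3]; exact h2
    rwa [ENNReal.add_div, ENNReal.mul_div_cancel_right hm0 hmt] at this
  have h5 : μ (K ∩ closedBall x R) / μ (closedBall x R) ≤ 1 - ENNReal.ofReal Q :=
    ENNReal.le_sub_of_add_le_right ENNReal.ofReal_ne_top h4
  exact absurd h1 (not_lt.2 h5)

/-- second order expansion at a good contact point -/
lemma contact_expansion (f : E → ℝ) (C : ℝ) (hC : 0 ≤ C) (K : Set E) (P : E → E) (Lp : ℝ)
    (hLp0 : 0 ≤ Lp)
    (hLp : ∀ y z, ‖P y - P z‖ ≤ Lp * ‖y - z‖)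
    (hK : ∀ y ∈ K, ∀ z, |f z - f y - ⟪P y, z - y⟫| ≤ C * ‖z - y‖ ^ 2)
    (x : E) (L : E →L[ℝ] E) (hL : HasFDerivAt P L x)
    (hnear : ∀ τ > 0, ∃ r > 0, ∀ y, ‖y - x‖ < r → ∃ y' ∈ K, ‖y - y'‖ ≤ τ * ‖y - x‖) :
    ∀ ν > 0, ∃ r > 0, ∀ u : E, ‖u‖ < r →
      |f (x + u) - f x - ⟪P x, u⟫ - (1 / 2) * ⟪L u, u⟫| ≤ ν * ‖u‖ ^ 2 := by
  intro ν hν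
  obtain ⟨n, hn⟩ := exists_nat_gt ((5 * C + Lp + 1 + ‖L‖) / ν)
  have hn0 : (0 : ℝ) < n := lt_of_le_of_lt (by positivity) hn
  have hnν : (5 * C + Lp + 1 + ‖L‖) / n ≤ ν := by
    rw [div_lt_iff₀ hν] at hn
    rw [div_le_iff₀ hn0]; linarith
  set τ : ℝ := 1 / n with hτ
  have hτ0 : 0 < τ := by positivity
  obtain ⟨r1, hr1, H1⟩ := hnear τ hτ0
  have H2 := (hasFDerivAt_iff_isLittleO_nhds_zero.1 hL).def hτ0
  rw [Metric.eventually_nhds_iff] at H2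
  obtain ⟨r2, hr2, H2⟩ := H2
  refine ⟨min r1 r2, lt_min hr1 hr2, fun u hu => ?_⟩
  have hu1 := lt_of_lt_of_le hu (min_le_left _ _)
  have hu2 := lt_of_lt_of_le hu (min_le_right _ _)
  set D : ℝ := 5 * C + Lp + 1 with hD
  have step : ∀ k : ℕ, k < n →
      |f (x + ((k + 1 : ℕ) * τ) • u) - f (x + (k * τ) • u) - τ * ⟪P x, u⟫
        - k * τ ^ 2 * ⟪L u, u⟫| ≤ D * τ ^ 2 * ‖u‖ ^ 2 := by
    intro k hk
    have hkτ0 : 0 ≤ (k : ℝ) * τ := by positivity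
    have hkτ : (k : ℝ) * τ ≤ 1 := by
      rw [hτ, mul_one_div, div_le_one hn0]; exact_mod_cast hk.le
    set y := x + (k * τ) • u with hy
    have hyx : y - x = ((k : ℝ) * τ) • u := by rw [hy]; abel
    have hyxn : ‖y - x‖ ≤ ‖u‖ := by
      rw [hyx, norm_smul, Real.norm_eq_abs, abs_of_nonneg hkτ0]
      exact mul_le_of_le_one_left (norm_nonneg _) hkτ
    obtain ⟨y', hy', hyy'⟩ := H1 y (hyxn.trans_lt hu1)
    have hyy : ‖y - y'‖ ≤ τ * ‖u‖ := hyy'.trans (by gcongr)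
    have hy2 : x + ((k + 1 : ℕ) * τ) • u = y + τ • u := by
      rw [hy]; push_cast; module
    rw [hy2]
    have a1 := hK y' hy' y
    have a2 := hK y' hy' (y + τ • u)
    have b2 : ‖y + τ • u - y'‖ ≤ 2 * (τ * ‖u‖) := by
      have : y + τ • u - y' = (y - y') + τ • u := by abel
      rw [this]
      refine (norm_add_le _ _).trans ?_
      rw [norm_smul, Real.norm_eq_abs, abs_of_pos hτ0]; linarith
    have c1 : C * ‖y - y'‖ ^ 2 ≤ C * (τ * ‖u‖) ^ 2 := by gcongr
    have c2 : C * ‖y + τ • u - y'‖ ^ 2 ≤ C * (2 * (τ * ‖u‖)) ^ 2 := by gcongr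
    have e1 : ⟪P y', y + τ • u - y'⟫ - ⟪P y', y - y'⟫ = τ * ⟪P y', u⟫ := by
      rw [← inner_sub_right, ← inner_smul_right]; congr 1; abel
    have d1 : ‖P y' - P x - L (y - x)‖ ≤ (Lp + 1) * (τ * ‖u‖) := by
      have q1 := hLp y' y
      have q2 := H2 (y := y - x) (by rw [dist_zero_right]; exact hyxn.trans_lt hu2)
      rw [add_sub_cancel] at q2
      have : P y' - P x - L (y - x) = (P y' - P y) + (P y - P x - L (y - x)) := by abel
      rw [this]
      refine (norm_add_le _ _).trans ?_
      rw [norm_sub_rev y' y] at q1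
      have q3 : Lp * ‖y - y'‖ ≤ Lp * (τ * ‖u‖) := by gcongr
      have q4 : τ * ‖y - x‖ ≤ τ * ‖u‖ := by gcongr
      linarith
    have d2 : |⟪P y' - P x - L (y - x), u⟫| ≤ (Lp + 1) * (τ * ‖u‖) * ‖u‖ :=
      (abs_real_inner_le_norm _ _).trans (by gcongr)
    have d3 : ⟪P y' - P x - L (y - x), u⟫ = ⟪P y', u⟫ - ⟪P x, u⟫ - k * τ * ⟪L u, u⟫ := by
      rw [hyx, inner_sub_left, inner_sub_left, map_smul, real_inner_smul_left]
    rw [d3] at d2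
    have d4 : |τ * (⟪P y', u⟫ - ⟪P x, u⟫ - k * τ * ⟪L u, u⟫)|
        ≤ τ * ((Lp + 1) * (τ * ‖u‖) * ‖u‖) := by
      rw [abs_mul, abs_of_pos hτ0]; gcongr
    rw [abs_le] at a1 a2 d4 ⊢
    constructor <;> linarith
  have sum : ∀ k : ℕ, k ≤ n →
      |f (x + (k * τ) • u) - f x - k * τ * ⟪P x, u⟫ - (k * (k - 1) / 2) * τ ^ 2 * ⟪L u, u⟫|
        ≤ k * (D * τ ^ 2 * ‖u‖ ^ 2) := by
    intro k
    induction k with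
    | zero => intro _; simp
    | succ k ih =>
      intro hk
      have i1 := ih (by omega)
      have i2 := step k (by omega)
      rw [abs_le] at i1 i2 ⊢
      push_cast at i2 ⊢
      constructor <;> linarith
  have fin := sum n le_rfl
  have hnτ : (n : ℝ) * τ = 1 := by rw [hτ]; field_simp
  have e2 : (n * (n - 1) / 2 : ℝ) * τ ^ 2 = 1 / 2 - τ / 2 := by
    have : (n * (n - 1) / 2 : ℝ) * τ ^ 2 = (n * τ) * (n * τ) / 2 - (n * τ) * τ / 2 := by ring
    rw [this, hnτ]; ring
  have e3 : (n : ℝ) * (D * τ ^ 2 * ‖u‖ ^ 2) = D * τ * ‖u‖ ^ 2 := by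
    have : (n : ℝ) * (D * τ ^ 2 * ‖u‖ ^ 2) = (n * τ) * D * τ * ‖u‖ ^ 2 := by ring
    rw [this, hnτ]; ring
  rw [e2, e3, hnτ, one_smul, one_mul] at fin
  have hLu : |⟪L u, u⟫| ≤ ‖L‖ * ‖u‖ ^ 2 := by
    refine (abs_real_inner_le_norm _ _).trans ?_
    have := L.le_opNorm u
    nlinarith [norm_nonneg u]
  have hLu2 : |τ / 2 * ⟪L u, u⟫| ≤ τ * (‖L‖ * ‖u‖ ^ 2) := by
    rw [abs_mul, abs_of_pos (by positivity)]
    have : 0 ≤ |⟪L u, u⟫| := abs_nonneg _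
    nlinarith
  have hfinal : (D * τ + τ * ‖L‖) * ‖u‖ ^ 2 ≤ ν * ‖u‖ ^ 2 := by
    have : D * τ + τ * ‖L‖ ≤ ν := by
      have : D * τ + τ * ‖L‖ = (5 * C + Lp + 1 + ‖L‖) / n := by rw [hτ, hD]; ring
      rw [this]; exact hnν
    gcongr
  rw [abs_le] at fin hLu2 ⊢
  constructor <;> linarith

end Jensen2

section Jensen3

open Topology MeasureTheory

variable {E : Type*} [NormedAddCommGroup E] [InnerProductSpace ℝ E] 

lemma exists_contact [FiniteDimensional ℝ E] (f : E → ℝ) (hf : Continuous f) (c C1 : ℝ)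
    (hc : 0 < c) (hgrow : ∀ y, f y ≤ C1 - c * ‖y‖ ^ 2) (p : E) :
    ∃ x, ∀ y, f y ≤ f x + ⟪p, y - x⟫ := by
  have hcont : Continuous (fun y => f y - ⟪p, y⟫) := by fun_prop
  have ht : Tendsto (fun y => f y - ⟪p, y⟫) (cocompact E) atBot := by
    have h1 : ∀ y, f y - ⟪p, y⟫ ≤ (C1 + ‖p‖ ^ 2 / (2 * c)) + (-(c / 2)) * ‖y‖ ^ 2 := by
      intro y
      have h2 := hgrow y
      have h3 := (abs_le.1 (abs_real_inner_le_norm p y)).1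
      have h4 : ‖p‖ * ‖y‖ ≤ ‖p‖ ^ 2 / (2 * c) + c / 2 * ‖y‖ ^ 2 := by
        have : ‖p‖ ^ 2 / (2 * c) + c / 2 * ‖y‖ ^ 2 - ‖p‖ * ‖y‖
          = (‖p‖ - c * ‖y‖) ^ 2 / (2 * c) := by field_simp; ring
        have h5 : 0 ≤ (‖p‖ - c * ‖y‖) ^ 2 / (2 * c) := by positivity
        linarith
      linarith
    refine tendsto_atBot_mono h1 ?_
    apply tendsto_atBot_add_const_left
    apply Tendsto.const_mul_atTop_of_neg (by linarith)
    exact (tendsto_pow_atTop two_ne_zero).comp (tendsto_norm_cocompact_atTop (E := E))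
  obtain ⟨x, hx⟩ := hcont.exists_forall_ge ht
  refine ⟨x, fun y => ?_⟩
  have := hx y
  rw [inner_sub_right]
  linarith

/-- Combined Jensen lemma / Alexandrov theorem -/
theorem jensen_alexandrov [FiniteDimensional ℝ E] (f : E → ℝ) (hf : Continuous f) (C : ℝ)
    (hC : 0 ≤ C)
    (hsc : ∀ x, ∃ g : E, ∀ y, f x + ⟪g, y - x⟫ - C * ‖y - x‖ ^ 2 ≤ f y)
    (c C1 : ℝ) (hc : 0 < c) (hgrow : ∀ y, f y ≤ C1 - c * ‖y‖ ^ 2) (δ : ℝ) (hδ : 0 < δ) :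
    ∃ (x p : E) (L : E →L[ℝ] E), ‖p‖ ≤ δ ∧ (∀ y, f y ≤ f x + ⟪p, y - x⟫) ∧
      ∀ ν > 0, ∃ r > 0, ∀ u : E, ‖u‖ < r →
        |f (x + u) - f x - ⟪p, u⟫ - (1 / 2) * ⟪L u, u⟫| ≤ ν * ‖u‖ ^ 2 := by
  classical
  letI : MeasurableSpace E := borel E
  haveI : BorelSpace E := ⟨rfl⟩
  set μ : Measure E := Measure.hausdorffMeasure (Module.finrank ℝ E : ℝ) with hμ
  haveI : μ.IsAddHaarMeasure := isAddHaarMeasure_hausdorffMeasure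
  set K : Set E := {x | ∃ p : E, ‖p‖ ≤ δ ∧ ∀ y, f y ≤ f x + ⟪p, y - x⟫} with hK
  have hch : ∀ x : E, ∃ p : E, x ∈ K → (‖p‖ ≤ δ ∧ ∀ y, f y ≤ f x + ⟪p, y - x⟫) := by
    intro x
    by_cases hx : x ∈ K
    · obtain ⟨p, hp⟩ := hx
      exact ⟨p, fun _ => hp⟩
    · exact ⟨0, fun h => absurd h hx⟩
  choose P hP using hch
  have hPl : ∀ x ∈ K, ∀ y, f x + ⟪P x, y - x⟫ - C * ‖y - x‖ ^ 2 ≤ f y := fun x hx =>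
    contact_lower f C hsc x (P x) (hP x hx).2
  have hlip : LipschitzOnWith (Real.toNNReal (2 * C)) P K := by
    apply LipschitzOnWith.of_dist_le_mul
    intro x hx y hy
    rw [dist_eq_norm, dist_eq_norm, Real.coe_toNNReal _ (by positivity)]
    exact contact_lip f C hC x (P x) y (P y) (hP x hx).2 (hPl x hx) (hPl y hy)
  have himg : ball (0 : E) δ ⊆ P '' K := by
    intro p hp
    obtain ⟨x, hx⟩ := exists_contact f hf c C1 hc hgrow p
    have hxK : x ∈ K := ⟨p, (mem_ball_zero_iff.1 hp).le, hx⟩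
    refine ⟨x, hxK, ?_⟩
    have := contact_lip f C hC x p x (P x) hx (contact_lower f C hsc x p hx) (hPl x hxK)
    rw [sub_self, norm_zero, mul_zero] at this
    exact (sub_eq_zero.1 (norm_le_zero_iff.1 this)).symm
  have hKpos : μ K ≠ 0 := by
    intro h0
    have h1 := hlip.hausdorffMeasure_image_le (d := (Module.finrank ℝ E : ℝ)) (by positivity)
    rw [← hμ, h0, mul_zero] at h1
    have h2 : μ (ball (0 : E) δ) ≤ 0 := (measure_mono himg).trans h1
    exact absurd h2 (not_le.2 (measure_ball_pos μ 0 hδ))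
  obtain ⟨Q, hQ, hPQ⟩ := hlip.extend_finite_dimension
  have hae1 : ∀ᵐ x ∂(μ.restrict K), DifferentiableAt ℝ Q x :=
    ae_restrict_of_ae (hQ.ae_differentiableAt)
  have hae2 := Besicovitch.ae_tendsto_measure_inter_div μ K
  obtain ⟨x, hxK, hx1, hx2⟩ : ∃ x ∈ K, DifferentiableAt ℝ Q x ∧
      Tendsto (fun r => μ (K ∩ closedBall x r) / μ (closedBall x r)) (𝓝[>] 0) (𝓝 1) := by
    by_contra! hcon
    have h1 := hae1.and hae2
    rw [ae_iff] at h1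
    apply hKpos
    apply le_antisymm _ (zero_le)
    rw [← h1]
    refine le_trans ?_ (Measure.le_restrict_apply _ _)
    apply measure_mono
    intro x hx
    refine ⟨?_, hx⟩
    rintro ⟨h2, h3⟩
    exact hcon x hx h2 h3
  refine ⟨x, P x, fderiv ℝ Q x, (hP x hxK).1, (hP x hxK).2, ?_⟩
  have := contact_expansion f C hC K Q (lipschitzExtensionConstant E * Real.toNNReal (2 * C) : ℝ≥0)
    (NNReal.coe_nonneg _) (fun y z => by simpa [dist_eq_norm] using hQ.dist_le_mul y z)
    (fun y hy z => by
      rw [← hPQ hy]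
      have h1 := hPl y hy z
      have h2 := (hP y hy).2 z
      rw [abs_le]
      have : 0 ≤ C * ‖z - y‖ ^ 2 := by positivity
      constructor <;> linarith)
    x (fderiv ℝ Q x) hx1.hasFDerivAt
    (fun τ hτ => density_near μ K x hxK hx2 τ hτ)
  rw [hPQ hxK]
  exact this

end Jensen3

section Sums

open Topology

variable {F : Type*} [NormedAddCommGroup F] [InnerProductSpace ℝ F] 

/-- sup-convolution over a compact set -/
lemma exists_supconv (D : Set F) (hD : IsCompact D) (hne : D.Nonempty) (v : F → ℝ)
    (hv : UpperSemicontinuousOn v D) (ε : ℝ) (hε : 0 < ε) :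
    ∃ (V : F → ℝ) (a : F → F) (C1 : ℝ), (∀ z, a z ∈ D) ∧
      (∀ z, V z = v (a z) - ‖z - a z‖ ^ 2 / (2 * ε)) ∧
      (∀ z, ∀ b ∈ D, v b - ‖z - b‖ ^ 2 / (2 * ε) ≤ V z) ∧
      (∀ z z', V z + ⟪(1 / ε) • (a z - z), z' - z⟫ - 1 / (2 * ε) * ‖z' - z‖ ^ 2 ≤ V z') ∧
      Continuous V ∧ ∀ z, V z ≤ C1 - 1 / (4 * ε) * ‖z‖ ^ 2 := by
  have hmax : ∀ z : F, ∃ a ∈ D, ∀ b ∈ D,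
      v b - ‖z - b‖ ^ 2 / (2 * ε) ≤ v a - ‖z - a‖ ^ 2 / (2 * ε) := by
    intro z
    have h1 : UpperSemicontinuousOn (fun b => v b + -(‖z - b‖ ^ 2 / (2 * ε))) D := by
      apply UpperSemicontinuousOn.add hv
      apply ContinuousOn.upperSemicontinuousOn
      fun_prop
    obtain ⟨a, ha, hb⟩ := UpperSemicontinuousOn.exists_isMaxOn hne hD h1
    refine ⟨a, ha, fun b hb' => ?_⟩
    have := hb hb'
    simp only [mem_ofPred_eq] at this
    linarith
  choose a ha hmax using hmax
  set V : F → ℝ := fun z => v (a z) - ‖z - a z‖ ^ 2 / (2 * ε) with hV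
  obtain ⟨R, hR⟩ := hD.isBounded.exists_norm_le
  have hR0 : 0 ≤ R := (norm_nonneg _).trans (hR _ hne.some_mem)
  have hsc : ∀ z z', V z + ⟪(1 / ε) • (a z - z), z' - z⟫ - 1 / (2 * ε) * ‖z' - z‖ ^ 2 ≤ V z' := by
    intro z z'
    have h1 := hmax z' (a z) (ha z)
    have h2 : ‖z' - a z‖ ^ 2 = ‖z - a z‖ ^ 2 - 2 * ⟪a z - z, z' - z⟫ + ‖z' - z‖ ^ 2 := by
      have : z' - a z = (z' - z) - (a z - z) := by abel
      rw [this, norm_sub_sq_real, norm_sub_rev (a z) z, real_inner_comm]; ring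
    simp only [hV]
    rw [real_inner_smul_left]
    rw [h2] at h1
    have h3 : v (a z) - ‖z - a z‖ ^ 2 / (2 * ε) + 1 / ε * ⟪a z - z, z' - z⟫
        - 1 / (2 * ε) * ‖z' - z‖ ^ 2
        = v (a z) - (‖z - a z‖ ^ 2 - 2 * ⟪a z - z, z' - z⟫ + ‖z' - z‖ ^ 2) / (2 * ε) := by
      field_simp; ring
    rw [h3]; exact h1
  have hlow : ∀ z z', -(1 / ε * (R + ‖z‖) * ‖z' - z‖ + 1 / (2 * ε) * ‖z' - z‖ ^ 2)
      ≤ V z' - V z := by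
    intro z z'
    have h1 := hsc z z'
    have h2 := (abs_le.1 (abs_real_inner_le_norm ((1 / ε) • (a z - z)) (z' - z))).1
    have h3 : ‖(1 / ε) • (a z - z)‖ ≤ 1 / ε * (R + ‖z‖) := by
      rw [norm_smul, Real.norm_eq_abs, abs_of_pos (by positivity)]
      gcongr
      exact (norm_sub_le _ _).trans (by linarith [hR _ (ha z)])
    have h4 : ‖(1 / ε) • (a z - z)‖ * ‖z' - z‖ ≤ 1 / ε * (R + ‖z‖) * ‖z' - z‖ := by gcongr
    linarith
  have hcont : Continuous V := by
    rw [continuous_iff_continuousAt]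
    intro z
    rw [ContinuousAt, tendsto_iff_norm_sub_tendsto_zero]
    have hb : ∀ z', ‖V z' - V z‖ ≤ 1 / ε * (R + ‖z‖ + ‖z'‖) * ‖z' - z‖
        + 1 / (2 * ε) * ‖z' - z‖ ^ 2 := by
      intro z'
      have h1 := hlow z z'
      have h2 := hlow z' z
      rw [norm_sub_rev z z'] at h2
      have h3 : 0 ≤ 1 / ε * ‖z‖ * ‖z' - z‖ := by positivity
      have h4 : 0 ≤ 1 / ε * ‖z'‖ * ‖z' - z‖ := by positivity
      rw [Real.norm_eq_abs, abs_le]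
      constructor <;> linarith
    refine squeeze_zero (fun _ => norm_nonneg _) hb ?_
    have : Continuous (fun z' : F => 1 / ε * (R + ‖z‖ + ‖z'‖) * ‖z' - z‖
        + 1 / (2 * ε) * ‖z' - z‖ ^ 2) := by fun_prop
    have h := this.tendsto z
    simpa using h
  obtain ⟨a0, ha0, hb0⟩ := UpperSemicontinuousOn.exists_isMaxOn hne hD hv
  refine ⟨V, a, v a0 + R ^ 2 / (2 * ε), ha, fun z => rfl, hmax, hsc, hcont, fun z => ?_⟩
  have h1 : v (a z) ≤ v a0 := hb0 (ha z)
  have h2 : ‖z‖ ^ 2 / 2 - R ^ 2 ≤ ‖z - a z‖ ^ 2 := by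
    have h3 : ‖z‖ ≤ ‖z - a z‖ + R := by
      have := norm_add_le (z - a z) (a z)
      rw [sub_add_cancel] at this
      linarith [hR _ (ha z)]
    have h4 := norm_nonneg z
    have h5 : ‖z‖ ^ 2 ≤ (‖z - a z‖ + R) ^ 2 := by gcongr
    nlinarith [sq_nonneg (‖z - a z‖ - R)]
  have h3 : (‖z‖ ^ 2 / 2 - R ^ 2) / (2 * ε) ≤ ‖z - a z‖ ^ 2 / (2 * ε) := by gcongr
  have h4 : (‖z‖ ^ 2 / 2 - R ^ 2) / (2 * ε) = 1 / (4 * ε) * ‖z‖ ^ 2 - R ^ 2 / (2 * ε) := by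
    field_simp; ring
  simp only [hV]
  linarith

end Sums

section Sums2

open Topology

variable {F : Type*} [NormedAddCommGroup F] [InnerProductSpace ℝ F] 

/-- Perturbed maximum point of a sum of two semiconvex functions minus the quadratic penalty. -/
lemma sums_aux [FiniteDimensional ℝ F] (V1 V2 : F → ℝ) (ε : ℝ) (hε : 0 < ε)
    (hc1 : Continuous V1) (hc2 : Continuous V2)
    (hs1 : ∀ z, ∃ g : F, ∀ z', V1 z + ⟪g, z' - z⟫ - 1 / (2 * ε) * ‖z' - z‖ ^ 2 ≤ V1 z')
    (hs2 : ∀ z, ∃ g : F, ∀ z', V2 z + ⟪g, z' - z⟫ - 1 / (2 * ε) * ‖z' - z‖ ^ 2 ≤ V2 z')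
    (C1 C2 : ℝ) (hg1 : ∀ z, V1 z ≤ C1 - 1 / (4 * ε) * ‖z‖ ^ 2)
    (hg2 : ∀ z, V2 z ≤ C2 - 1 / (4 * ε) * ‖z‖ ^ 2) (δ : ℝ) (hδ : 0 < δ) :
    ∃ (ζ ω p1 p2 : F) (L1 L2 : F →L[ℝ] F), ‖p1‖ ≤ δ ∧ ‖p2‖ ≤ δ ∧
      (∀ a b, V1 a + V2 b - ‖a - b‖ ^ 2 / (2 * ε) ≤
        V1 ζ + V2 ω - ‖ζ - ω‖ ^ 2 / (2 * ε) + δ) ∧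
      (∀ ν > 0, ∃ r > 0, ∀ h : F, ‖h‖ < r →
        V1 (ζ + h) ≤ V1 ζ + ⟪(1 / ε) • (ζ - ω) + p1, h⟫ + (1 / 2) * ⟪L1 h, h⟫ + ν * ‖h‖ ^ 2) ∧
      (∀ ν > 0, ∃ r > 0, ∀ h : F, ‖h‖ < r →
        V2 (ω + h) ≤ V2 ω + ⟪-((1 / ε) • (ζ - ω)) + p2, h⟫ + (1 / 2) * ⟪L2 h, h⟫
          + ν * ‖h‖ ^ 2) ∧
      (∀ h k, ⟪L1 h, h⟫ + ⟪L2 k, k⟫ ≤ ‖h - k‖ ^ 2 / ε) := by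
  classical
  let E := WithLp 2 (F × F)
  let f : E → ℝ := fun z => V1 z.fst + V2 z.snd - ‖z.fst - z.snd‖ ^ 2 / (2 * ε)
  have hf1 : Continuous (fun z : E => z.fst) := by fun_prop
  have hf2 : Continuous (fun z : E => z.snd) := by fun_prop
  have hfc : Continuous f := by
    have h1 := hc1.comp hf1
    have h2 := hc2.comp hf2
    exact (h1.add h2).sub (((hf1.sub hf2).norm.pow 2).div_const _)
  have hadd1 : ∀ z z' : E, (z + z').fst = z.fst + z'.fst := fun _ _ => rfl
  have hadd2 : ∀ z z' : E, (z + z').snd = z.snd + z'.snd := fun _ _ => rfl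
  have hsub1 : ∀ z z' : E, (z - z').fst = z.fst - z'.fst := fun _ _ => rfl
  have hsub2 : ∀ z z' : E, (z - z').snd = z.snd - z'.snd := fun _ _ => rfl
  have hnsq : ∀ z : E, ‖z‖ ^ 2 = ‖z.fst‖ ^ 2 + ‖z.snd‖ ^ 2 := fun z =>
    WithLp.prod_norm_sq_eq_of_L2 z
  have hin : ∀ z z' : E, ⟪z, z'⟫ = ⟪z.fst, z'.fst⟫ + ⟪z.snd, z'.snd⟫ := fun z z' =>
    WithLp.prod_inner_apply z z'
  have hfsc : ∀ x : E, ∃ g : E, ∀ y, f x + ⟪g, y - x⟫ - (3 / (2 * ε)) * ‖y - x‖ ^ 2 ≤ f y := by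
    intro x
    obtain ⟨g1, hg1⟩ := hs1 x.fst
    obtain ⟨g2, hg2⟩ := hs2 x.snd
    refine ⟨WithLp.toLp 2 (g1 - (1 / ε) • (x.fst - x.snd), g2 + (1 / ε) • (x.fst - x.snd)),
      fun y => ?_⟩
    have h1 := hg1 y.fst
    have h2 := hg2 y.snd
    rw [hin, hnsq]
    simp only [f, hsub1, hsub2, WithLp.toLp_fst, WithLp.toLp_snd]
    set h := y.fst - x.fst with hh
    set k := y.snd - x.snd with hk
    have e1 : y.fst - y.snd = (x.fst - x.snd) + (h - k) := by rw [hh, hk]; abel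
    clear_value h k
    rw [e1, norm_add_sq_real, inner_sub_left, inner_add_left, real_inner_smul_left,
      real_inner_smul_left, inner_sub_right]
    have e2 : ‖h - k‖ ^ 2 ≤ 2 * ‖h‖ ^ 2 + 2 * ‖k‖ ^ 2 := by
      have := norm_sub_le h k
      have h0 := norm_nonneg (h - k)
      have h3 : ‖h - k‖ ^ 2 ≤ (‖h‖ + ‖k‖) ^ 2 := by gcongr
      nlinarith [sq_nonneg (‖h‖ - ‖k‖)]
    have e3 : ‖h - k‖ ^ 2 / (2 * ε) ≤ (2 * ‖h‖ ^ 2 + 2 * ‖k‖ ^ 2) / (2 * ε) := by gcongr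
    have e4 : (‖x.fst - x.snd‖ ^ 2 + 2 * (⟪x.fst - x.snd, h⟫ - ⟪x.fst - x.snd, k⟫)
        + ‖h - k‖ ^ 2) / (2 * ε) = ‖x.fst - x.snd‖ ^ 2 / (2 * ε)
        + 1 / ε * ⟪x.fst - x.snd, h⟫ - 1 / ε * ⟪x.fst - x.snd, k⟫ + ‖h - k‖ ^ 2 / (2 * ε) := by
      field_simp; ring
    have e5 : 3 / (2 * ε) * (‖h‖ ^ 2 + ‖k‖ ^ 2) = 1 / (2 * ε) * ‖h‖ ^ 2 + 1 / (2 * ε) * ‖k‖ ^ 2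
        + (2 * ‖h‖ ^ 2 + 2 * ‖k‖ ^ 2) / (2 * ε) := by field_simp; ring
    rw [e4, e5]
    linarith
  have hfg : ∀ y : E, f y ≤ (C1 + C2) - (1 / (4 * ε)) * ‖y‖ ^ 2 := by
    intro y
    have h1 := hg1 y.fst
    have h2 := hg2 y.snd
    have h3 : 0 ≤ ‖y.fst - y.snd‖ ^ 2 / (2 * ε) := by positivity
    rw [hnsq]
    simp only [f]
    linarith
  -- a bound for contact points
  obtain ⟨Rb, hRb0, hRb⟩ : ∃ Rb : ℝ, 0 < Rb ∧ ∀ x : E, ∀ s, s ≤ 1 → f 0 ≤ f x + s * ‖x‖ →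
      ‖x‖ ≤ Rb := by
    refine ⟨4 * ε * (|C1 + C2 - f 0| + 1) + 1, by positivity, fun x s hs hx => ?_⟩
    have h1 := hfg x
    by_contra! hcon
    have h0 := norm_nonneg x
    have h2 : s * ‖x‖ ≤ ‖x‖ := mul_le_of_le_one_left h0 hs
    have h3 : (1 / (4 * ε)) * ‖x‖ ^ 2 ≤ |C1 + C2 - f 0| + ‖x‖ := by
      linarith [le_abs_self (C1 + C2 - f 0)]
    have h4 : ‖x‖ ^ 2 ≤ 4 * ε * (|C1 + C2 - f 0| + ‖x‖) := by
      have : ‖x‖ ^ 2 = 4 * ε * ((1 / (4 * ε)) * ‖x‖ ^ 2) := by field_simp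
      rw [this]; gcongr
    have h5 : 0 ≤ |C1 + C2 - f 0| := abs_nonneg _
    have h6 : 1 ≤ ‖x‖ := by
      have : 0 ≤ 4 * ε * (|C1 + C2 - f 0| + 1) := by positivity
      linarith
    have h7 : ‖x‖ ^ 2 ≤ 4 * ε * (|C1 + C2 - f 0| + 1) * ‖x‖ := by
      refine h4.trans ?_
      have h8 : |C1 + C2 - f 0| + ‖x‖ ≤ (|C1 + C2 - f 0| + 1) * ‖x‖ := by nlinarith
      rw [mul_assoc (4 * ε)]
      exact mul_le_mul_of_nonneg_left h8 (by positivity)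
    nlinarith
  -- the maximum of `f`
  obtain ⟨xm, hxm⟩ := exists_contact f hfc _ _ (by positivity) hfg 0
  simp only [inner_zero_left, add_zero] at hxm
  set δ' := min 1 (min δ (δ / (Rb + ‖xm‖ + 1))) with hδ'
  have hδ'0 : 0 < δ' := by positivity
  have hδ'1 : δ' ≤ 1 := min_le_left _ _
  have hδ'2 : δ' ≤ δ := (min_le_right _ _).trans (min_le_left _ _)
  have hδ'3 : δ' * (Rb + ‖xm‖) ≤ δ := by
    have : δ' ≤ δ / (Rb + ‖xm‖ + 1) := (min_le_right _ _).trans (min_le_right _ _)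
    rw [le_div_iff₀ (by positivity)] at this
    nlinarith
  obtain ⟨x, p, L, hp, hcon, hexp⟩ := jensen_alexandrov f hfc (3 / (2 * ε)) (by positivity) hfsc
    _ _ (by positivity) hfg δ' hδ'0
  have hxb : ‖x‖ ≤ Rb := by
    apply hRb x δ' hδ'1
    have h1 := hcon 0
    have h2 := real_inner_le_norm p (0 - x)
    rw [zero_sub, norm_neg] at h2
    rw [zero_sub] at h1
    have h3 : ‖p‖ * ‖x‖ ≤ δ' * ‖x‖ := by gcongr
    linarith
  have hmax : ∀ z, f z ≤ f x + δ := by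
    intro z
    have h1 := hcon xm
    have h2 := real_inner_le_norm p (xm - x)
    have h3 := norm_sub_le xm x
    have h4 : ‖p‖ * ‖xm - x‖ ≤ δ' * (Rb + ‖xm‖) := by
      gcongr; linarith
    linarith [hxm z]
  have hpn : ‖p.fst‖ ≤ δ' ∧ ‖p.snd‖ ≤ δ' := by
    have h1 := hnsq p
    have h2 : ‖p‖ ^ 2 ≤ δ' ^ 2 := by gcongr
    constructor
    · exact abs_le_of_sq_le_sq' (by nlinarith [sq_nonneg ‖p.snd‖]) hδ'0.le |>.2
    · exact abs_le_of_sq_le_sq' (by nlinarith [sq_nonneg ‖p.fst‖]) hδ'0.le |>.2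
  let e := WithLp.prodContinuousLinearEquiv 2 ℝ F F
  let inl : F →L[ℝ] E := (e.symm : (F × F) →L[ℝ] E) ∘L ContinuousLinearMap.inl ℝ F F
  let inr : F →L[ℝ] E := (e.symm : (F × F) →L[ℝ] E) ∘L ContinuousLinearMap.inr ℝ F F
  let fs : E →L[ℝ] F := ContinuousLinearMap.fst ℝ F F ∘L (e : E →L[ℝ] (F × F))
  let sn : E →L[ℝ] F := ContinuousLinearMap.snd ℝ F F ∘L (e : E →L[ℝ] (F × F))
  have inl1 : ∀ h, (inl h).fst = h := fun h => rfl
  have inl2 : ∀ h, (inl h).snd = 0 := fun h => rfl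
  have inr1 : ∀ h, (inr h).fst = 0 := fun h => rfl
  have inr2 : ∀ h, (inr h).snd = h := fun h => rfl
  have fs1 : ∀ z, fs z = z.fst := fun z => rfl
  have sn1 : ∀ z, sn z = z.snd := fun z => rfl
  have ninl : ∀ h, ‖inl h‖ = ‖h‖ := by
    intro h
    have := hnsq (inl h)
    rw [inl1, inl2, norm_zero, zero_pow two_ne_zero, add_zero] at this
    exact (sq_eq_sq₀ (norm_nonneg _) (norm_nonneg _)).1 this
  have ninr : ∀ h, ‖inr h‖ = ‖h‖ := by
    intro h
    have := hnsq (inr h)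
    rw [inr1, inr2, norm_zero, zero_pow two_ne_zero, zero_add] at this
    exact (sq_eq_sq₀ (norm_nonneg _) (norm_nonneg _)).1 this
  let L1 : F →L[ℝ] F := fs ∘L L ∘L inl + (1 / ε) • ContinuousLinearMap.id ℝ F
  let L2 : F →L[ℝ] F := sn ∘L L ∘L inr + (1 / ε) • ContinuousLinearMap.id ℝ F
  have L1e : ∀ h, ⟪L1 h, h⟫ = ⟪L (inl h), inl h⟫ + 1 / ε * ‖h‖ ^ 2 := by
    intro h
    rw [hin, inl1, inl2, inner_zero_right, add_zero]
    simp only [L1, ContinuousLinearMap.add_apply, ContinuousLinearMap.comp_apply,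
      ContinuousLinearMap.smul_apply, ContinuousLinearMap.id_apply, fs1]
    rw [inner_add_left, real_inner_smul_left, real_inner_self_eq_norm_sq]
  have L2e : ∀ h, ⟪L2 h, h⟫ = ⟪L (inr h), inr h⟫ + 1 / ε * ‖h‖ ^ 2 := by
    intro h
    rw [hin, inr1, inr2, inner_zero_right, zero_add]
    simp only [L2, ContinuousLinearMap.add_apply, ContinuousLinearMap.comp_apply,
      ContinuousLinearMap.smul_apply, ContinuousLinearMap.id_apply, sn1]
    rw [inner_add_left, real_inner_smul_left, real_inner_self_eq_norm_sq]
  have E1 : ∀ ν > 0, ∃ r > 0, ∀ h : F, ‖h‖ < r →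
      |V1 (x.fst + h) - V1 x.fst - ⟪(1 / ε) • (x.fst - x.snd) + p.fst, h⟫
        - (1 / 2) * ⟪L1 h, h⟫| ≤ ν * ‖h‖ ^ 2 := by
    intro ν hν
    obtain ⟨r, hr, hh⟩ := hexp ν hν
    refine ⟨r, hr, fun h hhr => ?_⟩
    have h1 := hh (inl h) (by rw [ninl]; exact hhr)
    rw [ninl, hin p, inl1, inl2, inner_zero_right, add_zero] at h1
    rw [L1e]
    simp only [f, hadd1, hadd2, inl1, inl2, add_zero] at h1
    have e1 : x.fst + h - x.snd = (x.fst - x.snd) + h := by abel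
    rw [e1, norm_add_sq_real] at h1
    rw [inner_add_left, real_inner_smul_left]
    convert h1 using 2
    field_simp
    ring
  have E2 : ∀ ν > 0, ∃ r > 0, ∀ h : F, ‖h‖ < r →
      |V2 (x.snd + h) - V2 x.snd - ⟪-((1 / ε) • (x.fst - x.snd)) + p.snd, h⟫
        - (1 / 2) * ⟪L2 h, h⟫| ≤ ν * ‖h‖ ^ 2 := by
    intro ν hν
    obtain ⟨r, hr, hh⟩ := hexp ν hν
    refine ⟨r, hr, fun h hhr => ?_⟩
    have h1 := hh (inr h) (by rw [ninr]; exact hhr)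
    rw [ninr, hin p, inr1, inr2, inner_zero_right, zero_add] at h1
    rw [L2e]
    simp only [f, hadd1, hadd2, inr1, inr2, add_zero] at h1
    have e1 : x.fst - (x.snd + h) = (x.fst - x.snd) - h := by abel
    rw [e1, norm_sub_sq_real] at h1
    rw [inner_add_left, inner_neg_left, real_inner_smul_left]
    convert h1 using 2
    field_simp
    ring
  refine ⟨x.fst, x.snd, p.fst, p.snd, L1, L2, hpn.1.trans hδ'2, hpn.2.trans hδ'2, ?_, ?_, ?_, ?_⟩
  · intro a b
    exact hmax (WithLp.toLp 2 (a, b))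
  · intro ν hν
    obtain ⟨r, hr, hh⟩ := E1 ν hν
    refine ⟨r, hr, fun h hhr => ?_⟩
    have := (abs_le.1 (hh h hhr)).2
    linarith
  · intro ν hν
    obtain ⟨r, hr, hh⟩ := E2 ν hν
    refine ⟨r, hr, fun h hhr => ?_⟩
    have := (abs_le.1 (hh h hhr)).2
    linarith
  · intro h k
    apply le_of_forall_pos_le_add
    intro η hη
    obtain ⟨ν, hν, hνη⟩ : ∃ ν > 0, 2 * ν * (‖h‖ ^ 2 + ‖k‖ ^ 2) ≤ η := by
      refine ⟨η / (2 * (‖h‖ ^ 2 + ‖k‖ ^ 2 + 1)), by positivity, ?_⟩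
      have : 2 * (η / (2 * (‖h‖ ^ 2 + ‖k‖ ^ 2 + 1))) * (‖h‖ ^ 2 + ‖k‖ ^ 2)
        = η * ((‖h‖ ^ 2 + ‖k‖ ^ 2) / (‖h‖ ^ 2 + ‖k‖ ^ 2 + 1)) := by field_simp
      rw [this]
      apply mul_le_of_le_one_right hη.le
      rw [div_le_one (by positivity)]; linarith
    obtain ⟨r1, hr1, hh1⟩ := E1 ν hν
    obtain ⟨r2, hr2, hh2⟩ := E2 ν hν
    obtain ⟨s, hs0, hs1, hs2⟩ : ∃ s : ℝ, 0 < s ∧ ‖s • h‖ < r1 ∧ ‖s • k‖ < r2 := by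
      refine ⟨min r1 r2 / (‖h‖ + ‖k‖ + 1), by positivity, ?_, ?_⟩
      · rw [norm_smul, Real.norm_eq_abs, abs_of_pos (by positivity), div_mul_eq_mul_div,
          div_lt_iff₀ (by positivity)]
        have h1 := min_le_left r1 r2
        have h2 : 0 < min r1 r2 := lt_min hr1 hr2
        nlinarith [norm_nonneg h, norm_nonneg k]
      · rw [norm_smul, Real.norm_eq_abs, abs_of_pos (by positivity), div_mul_eq_mul_div,
          div_lt_iff₀ (by positivity)]
        have h1 := min_le_right r1 r2
        have h2 : 0 < min r1 r2 := lt_min hr1 hr2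
        nlinarith [norm_nonneg h, norm_nonneg k]
    have q1 := (abs_le.1 (hh1 (s • h) hs1)).1
    have q2 := (abs_le.1 (hh2 (s • k) hs2)).1
    have q3 := hcon (x + (inl (s • h) + inr (s • k)))
    rw [add_sub_cancel_left, hin p] at q3
    simp only [f, hadd1, hadd2, inl1, inl2, inr1, inr2, add_zero, zero_add] at q3
    have e1 : x.fst + s • h - (x.snd + s • k) = (x.fst - x.snd) + s • (h - k) := by
      rw [smul_sub]; abel
    rw [e1, norm_add_sq_real] at q3
    simp only [map_smul, inner_smul_right, real_inner_smul_left, inner_add_left, inner_neg_left,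
      norm_smul, Real.norm_eq_abs, abs_of_pos hs0, inner_sub_right, mul_pow] at q1 q2 q3
    have e2 : (‖x.fst - x.snd‖ ^ 2 + 2 * (s * (⟪x.fst - x.snd, h⟫ - ⟪x.fst - x.snd, k⟫))
        + s ^ 2 * ‖h - k‖ ^ 2) / (2 * ε) = ‖x.fst - x.snd‖ ^ 2 / (2 * ε)
        + s * (1 / ε * ⟪x.fst - x.snd, h⟫) - s * (1 / ε * ⟪x.fst - x.snd, k⟫)
        + s ^ 2 * (‖h - k‖ ^ 2 / ε) / 2 := by field_simp; ring
    rw [e2] at q3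
    have q4 : s ^ 2 * (⟪L1 h, h⟫ + ⟪L2 k, k⟫) ≤
        s ^ 2 * (‖h - k‖ ^ 2 / ε + 2 * ν * (‖h‖ ^ 2 + ‖k‖ ^ 2)) := by
      linarith
    have q5 := le_of_mul_le_mul_left q4 (by positivity)
    linarith

end Sums2

section Sums3

open Topology

variable {F : Type*} [NormedAddCommGroup F] [InnerProductSpace ℝ F] 

/-- Theorem on sums, for a compact set. -/
lemma sums_thm [FiniteDimensional ℝ F] (D : Set F) (hD : IsCompact D) (hne : D.Nonempty)
    (v w : F → ℝ) (hv : UpperSemicontinuousOn v D) (hw : LowerSemicontinuousOn w D)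
    (ε δ : ℝ) (hε : 0 < ε) (hδ : 0 < δ) :
    ∃ (ζ ω zs ws p1 p2 : F) (L1 L2 : F →L[ℝ] F), zs ∈ D ∧ ws ∈ D ∧ ‖p1‖ ≤ δ ∧ ‖p2‖ ≤ δ ∧
      (∀ a ∈ D, v a - w a ≤ v zs - w ws
        - (‖ζ - zs‖ ^ 2 + ‖ω - ws‖ ^ 2 + ‖ζ - ω‖ ^ 2) / (2 * ε) + δ) ∧
      (∀ ν > 0, ∃ r > 0, ∀ h : F, ‖h‖ < r → zs + h ∈ D →
        v (zs + h) ≤ v zs + ⟪(1 / ε) • (ζ - ω) + p1, h⟫ + (1 / 2) * ⟪L1 h, h⟫ + ν * ‖h‖ ^ 2) ∧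
      (∀ ν > 0, ∃ r > 0, ∀ h : F, ‖h‖ < r → ws + h ∈ D →
        w ws + ⟪(1 / ε) • (ζ - ω) - p2, h⟫ - (1 / 2) * ⟪L2 h, h⟫ - ν * ‖h‖ ^ 2 ≤ w (ws + h)) ∧
      (∀ h k, ⟪L1 h, h⟫ + ⟪L2 k, k⟫ ≤ ‖h - k‖ ^ 2 / ε) := by
  have hw' : UpperSemicontinuousOn (fun z => - w z) D := by
    intro x hx y hy
    have := hw x hx (-y) (by linarith)
    filter_upwards [this] with z hz
    linarith
  obtain ⟨V1, a1, C1, ha1, hV1, hb1, hs1, hc1, hg1⟩ := exists_supconv D hD hne v hv ε hε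
  obtain ⟨V2, a2, C2, ha2, hV2, hb2, hs2, hc2, hg2⟩ := exists_supconv D hD hne _ hw' ε hε
  obtain ⟨ζ, ω, p1, p2, L1, L2, hp1, hp2, hmax, hE1, hE2, hL⟩ := sums_aux V1 V2 ε hε hc1 hc2
    (fun z => ⟨_, hs1 z⟩) (fun z => ⟨_, hs2 z⟩) C1 C2 hg1 hg2 δ hδ
  refine ⟨ζ, ω, a1 ζ, a2 ω, p1, p2, L1, L2, ha1 _, ha2 _, hp1, hp2, ?_, ?_, ?_, hL⟩
  · intro a ha
    have h1 := hb1 a a ha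
    have h2 := hb2 a a ha
    have h3 := hmax a a
    simp only [sub_self, norm_zero] at h1 h2 h3
    rw [hV1 ζ, hV2 ω] at h3
    rw [add_div, add_div]
    norm_num at h1 h2 h3
    linarith
  · intro ν hν
    obtain ⟨r, hr, hh⟩ := hE1 ν hν
    refine ⟨r, hr, fun h hhr hhD => ?_⟩
    have h1 := hh h hhr
    have h2 := hb1 (ζ + h) _ hhD
    rw [hV1 ζ] at h1
    rw [add_sub_add_right_eq_sub] at h2
    linarith
  · intro ν hν
    obtain ⟨r, hr, hh⟩ := hE2 ν hν
    refine ⟨r, hr, fun h hhr hhD => ?_⟩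
    have h1 := hh h hhr
    have h2 := hb2 (ω + h) _ hhD
    rw [hV2 ω] at h1
    rw [add_sub_add_right_eq_sub] at h2
    rw [inner_add_left, inner_neg_left] at h1
    rw [inner_sub_left]
    linarith

/-- Semicontinuity near a closed set. -/
lemma near_bad {X : Type*} [MetricSpace X] (D C : Set X) (hD : IsCompact D) (hC : IsClosed C)
    (v w : X → ℝ) (hv : UpperSemicontinuousOn v D) (hw : LowerSemicontinuousOn w D) (l : ℝ)
    (h : ∀ z ∈ D ∩ C, v z - w z < l) :
    ∃ ρ > 0, ∀ a ∈ D, ∀ b ∈ D, dist a b ≤ ρ → (a ∈ C ∨ b ∈ C) → v a - w b < l := by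
  by_contra! hcon
  have hn : ∀ n : ℕ, (0:ℝ) < 1 / (n + 1) := fun n => by positivity
  choose a ha b hb hab hor hl using fun n : ℕ => hcon (1 / ((n : ℝ) + 1)) (hn n)
  obtain ⟨z, hz, φ, hφ, hlim⟩ := hD.tendsto_subseq ha
  have hd : Tendsto (fun n => dist (a (φ n)) (b (φ n))) atTop (𝓝 0) := by
    refine squeeze_zero (fun n => dist_nonneg) (fun n => hab (φ n)) ?_
    exact (tendsto_one_div_add_atTop_nhds_zero_nat).comp hφ.tendsto_atTop
  have hlimb : Tendsto (fun n => b (φ n)) atTop (𝓝 z) := by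
    rw [tendsto_iff_dist_tendsto_zero] at hlim ⊢
    have h1 := hd.add hlim
    rw [add_zero] at h1
    refine squeeze_zero (fun n => dist_nonneg) (fun n => ?_) h1
    exact (dist_triangle_left _ _ _)
  have hzC : z ∈ C := by
    by_contra hzC
    have hO : Cᶜ ∈ 𝓝 z := hC.isOpen_compl.mem_nhds hzC
    have h1 := hlim.eventually hO
    have h2 := hlimb.eventually hO
    obtain ⟨n, hn1, hn2⟩ := (h1.and h2).exists
    rcases hor (φ n) with h | h
    · exact hn1 h
    · exact hn2 h
  have h1 := h z ⟨hz, hzC⟩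
  set e := (l - (v z - w z)) / 2 with he
  have hev : ∀ᶠ x in 𝓝[D] z, v x < v z + e := hv z hz _ (by linarith)
  have hew : ∀ᶠ x in 𝓝[D] z, w z - e < w x := hw z hz _ (by linarith)
  have ta : Tendsto (fun n => a (φ n)) atTop (𝓝[D] z) :=
    tendsto_nhdsWithin_iff.2 ⟨hlim, Eventually.of_forall fun n => ha _⟩
  have tb : Tendsto (fun n => b (φ n)) atTop (𝓝[D] z) :=
    tendsto_nhdsWithin_iff.2 ⟨hlimb, Eventually.of_forall fun n => hb _⟩
  obtain ⟨n, hn1, hn2⟩ := ((ta.eventually hev).and (tb.eventually hew)).exists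
  have := hl (φ n)
  linarith

end Sums3

section Calc1

open Topology

/-- the `k`-th column of a matrix, as a Euclidean vector -/
def colv {d n : ℕ} (S : Matrix (Fin d) (Fin n) ℝ) (k : Fin n) : Euc d :=
  WithLp.toLp 2 (fun i => S i k)

/-- second derivative -/
def D2 (d : ℕ) (φ : ℝ × Euc d → ℝ) (z ξ η : ℝ × Euc d) : ℝ :=
  fderiv ℝ (fderiv ℝ φ) z ξ η

lemma sum_colv {d n : ℕ} (S : Matrix (Fin d) (Fin n) ℝ) :
    ∑ k, ‖colv S k‖ ^ 2 = matFrobNorm S ^ 2 := by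
  unfold matFrobNorm
  rw [Real.sq_sqrt (by positivity), Finset.sum_comm]
  refine Finset.sum_congr rfl fun k _ => ?_
  rw [EuclideanSpace.norm_sq_eq]
  simp [colv]

lemma colv_sub {d n : ℕ} (S S' : Matrix (Fin d) (Fin n) ℝ) (k : Fin n) :
    colv (S - S') k = colv S k - colv S' k := by
  ext i; simp [colv]

lemma timeDeriv_eq {d : ℕ} (φ : ℝ × Euc d → ℝ) (h : ContDiff ℝ 2 φ) (t : ℝ) (x : Euc d) :
    timeDeriv d φ t x = fderiv ℝ φ (t, x) (1, 0) := by
  have h1 : HasFDerivAt φ (fderiv ℝ φ (t, x)) (t, x) :=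
    (h.differentiable (by norm_num) _).hasFDerivAt
  have h2 : HasDerivAt (fun s : ℝ => (s, x)) ((1 : ℝ), (0 : Euc d)) t :=
    (hasDerivAt_id t).prodMk (hasDerivAt_const t x)
  exact (h1.comp_hasDerivAt t h2).deriv

lemma spacePartial_eq {d : ℕ} (φ : ℝ × Euc d → ℝ) (h : Differentiable ℝ φ) (i : Fin d)
    (t : ℝ) (x : Euc d) :
    spacePartial d i φ t x = fderiv ℝ φ (t, x) (0, EuclideanSpace.single i 1) := by
  have h1 : HasFDerivAt φ (fderiv ℝ φ (t, x)) (t, x) := (h _).hasFDerivAt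
  have h2 : HasFDerivAt (fun y : Euc d => (t, y)) (ContinuousLinearMap.inr ℝ ℝ (Euc d)) x :=
    hasFDerivAt_prodMk_right t x
  have h3 := (h1.comp x h2).fderiv
  unfold spacePartial
  have h4 : (fun y => φ (t, y)) = φ ∘ fun y => (t, y) := rfl
  rw [h4, h3]
  rfl

lemma spaceHessian_eq {d : ℕ} (φ : ℝ × Euc d → ℝ) (h : ContDiff ℝ 2 φ) (i j : Fin d)
    (t : ℝ) (x : Euc d) :
    spaceHessian d φ t x i j =
      D2 d φ (t, x) (0, EuclideanSpace.single i 1) (0, EuclideanSpace.single j 1) := by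
  have hd : Differentiable ℝ φ := h.differentiable (by norm_num)
  have hd2 : Differentiable ℝ (fderiv ℝ φ) :=
    (h.fderiv_right (m := 1) (by norm_num)).differentiable (by norm_num)
  have e1 : (fun p : ℝ × Euc d => spacePartial d j φ p.1 p.2)
      = fun p => fderiv ℝ φ p (0, EuclideanSpace.single j 1) := by
    funext p
    exact spacePartial_eq φ hd j p.1 p.2
  unfold spaceHessian
  rw [Matrix.of_apply, e1, spacePartial_eq]
  · unfold D2
    have h1 := (hd2 (t, x)).hasFDerivAt
    have h2 := h1.clm_apply (hasFDerivAt_const ((0 : ℝ), (EuclideanSpace.single j 1 : Euc d)) (t, x))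
    rw [h2.fderiv]
    simp
  · intro p
    exact (hd2 p).clm_apply (differentiableAt_const _)

lemma sum_single_euc {d : ℕ} (y : Euc d) :
    y = ∑ i, y i • (EuclideanSpace.single i 1 : Euc d) := by
  ext j
  simp [Finset.sum_apply, Pi.single_apply]

lemma inr_sum {d : ℕ} (y : Euc d) : ((0 : ℝ), y)
    = ∑ i, y i • ((0 : ℝ), (EuclideanSpace.single i 1 : Euc d)) := by
  conv_lhs => rw [sum_single_euc y]
  ext
  · simp [Prod.fst_sum]
  · simp [Prod.snd_sum]

lemma inner_spaceGrad {d : ℕ} (φ : ℝ × Euc d → ℝ) (h : ContDiff ℝ 2 φ) (t : ℝ) (x y : Euc d) :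
    ⟪spaceGrad d φ t x, y⟫ = fderiv ℝ φ (t, x) (0, y) := by
  have hd : Differentiable ℝ φ := h.differentiable (by norm_num)
  rw [inr_sum y, map_sum, PiLp.inner_apply]
  refine Finset.sum_congr rfl fun i _ => ?_
  rw [map_smul, ← spacePartial_eq φ hd]
  simp [spaceGrad]

lemma op_eq {d n : ℕ} (A : Euc d → Matrix (Fin d) (Fin d) ℝ) (σ : Euc d → Matrix (Fin d) (Fin n) ℝ)
    (hA : ∀ x, A x = σ x * (σ x).transpose) (H : Euc d → Euc d → ℝ)
    (φ : ℝ × Euc d → ℝ) (h : ContDiff ℝ 2 φ) (t : ℝ) (x : Euc d) :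
    parabolicOp d A H φ t x = fderiv ℝ φ (t, x) (1, 0)
      - ∑ k, D2 d φ (t, x) (0, colv (σ x) k) (0, colv (σ x) k) + H x (spaceGrad d φ t x) := by
  unfold parabolicOp
  rw [timeDeriv_eq φ h]
  congr 2
  have h1 : ∀ k, D2 d φ (t, x) (0, colv (σ x) k) (0, colv (σ x) k)
      = ∑ i, ∑ j, σ x i k * (σ x j k * spaceHessian d φ t x i j) := by
    intro k
    have e := inr_sum (colv (σ x) k)
    unfold D2
    rw [e]
    simp only [map_sum, map_smul, ContinuousLinearMap.sum_apply, smul_apply]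
    simp only [Finset.smul_sum]
    rw [Finset.sum_comm]
    refine Finset.sum_congr rfl fun i _ => ?_
    refine Finset.sum_congr rfl fun j _ => ?_
    rw [spaceHessian_eq φ h]
    simp only [D2, smul_eq_mul, colv]
    ring
  simp_rw [h1]
  rw [hA, Matrix.trace]
  simp only [Matrix.diag_apply, Matrix.mul_apply, Matrix.transpose_apply, Finset.sum_mul]
  -- LHS: ∑ i, ∑ j, ∑ k, σ i k * σ j k * Hess j i
  rw [Finset.sum_comm]
  simp_rw [Finset.sum_comm (s := (Finset.univ : Finset (Fin d))) (t := (Finset.univ : Finset (Fin n)))]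
  refine Finset.sum_congr rfl fun k _ => ?_
  refine Finset.sum_congr rfl fun i _ => ?_
  refine Finset.sum_congr rfl fun j _ => ?_
  ring

/-- one-dimensional computation of first and second derivatives -/
lemma dir_deriv {d : ℕ} (φ : ℝ × Euc d → ℝ) (h : ContDiff ℝ 2 φ) (z ξ : ℝ × Euc d) (g : ℝ → ℝ)
    (hg : ∀ s, HasDerivAt (fun s : ℝ => φ (z + s • ξ)) (g s) s) :
    fderiv ℝ φ z ξ = g 0 ∧ ∀ c, HasDerivAt g c 0 → D2 d φ z ξ ξ = c := by
  have hd : Differentiable ℝ φ := h.differentiable (by norm_num)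
  have hd2 : Differentiable ℝ (fderiv ℝ φ) :=
    (h.fderiv_right (m := 1) (by norm_num)).differentiable (by norm_num)
  have hl : ∀ s : ℝ, HasDerivAt (fun s : ℝ => z + s • ξ) ξ s := by
    intro s
    simpa using ((hasDerivAt_id s).smul_const ξ).const_add z
  have h1 : ∀ s : ℝ, fderiv ℝ φ (z + s • ξ) ξ = g s := by
    intro s
    have h2 := (hd (z + s • ξ)).hasFDerivAt.comp_hasDerivAt s (hl s)
    exact h2.unique (hg s)
  refine ⟨by simpa using h1 0, fun c hc => ?_⟩
  have e : g = fun s : ℝ => fderiv ℝ φ (z + s • ξ) ξ := by funext s; exact (h1 s).symm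
  rw [e] at hc
  have h3 := (hd2 (z + (0:ℝ) • ξ)).hasFDerivAt.comp_hasDerivAt (0:ℝ) (hl 0)
  have h4 := h3.clm_apply (hasDerivAt_const (0:ℝ) ξ)
  have h5 := h4.unique hc
  simpa [D2] using h5

end Calc1

section Calc2

open Topology

lemma comb_calc {d : ℕ} (φ ψ : ℝ × Euc d → ℝ) (hφ : ContDiff ℝ 2 φ) (hψ : ContDiff ℝ 2 ψ)
    (c : ℝ) : ContDiff ℝ 2 (fun z => c * (φ z + ψ z)) ∧
    (∀ z ξ, fderiv ℝ (fun z => c * (φ z + ψ z)) z ξ = c * (fderiv ℝ φ z ξ + fderiv ℝ ψ z ξ)) ∧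
    (∀ z ξ η, D2 d (fun z => c * (φ z + ψ z)) z ξ η = c * (D2 d φ z ξ η + D2 d ψ z ξ η)) ∧
    (∀ t x, spaceGrad d (fun z => c * (φ z + ψ z)) t x
      = c • (spaceGrad d φ t x + spaceGrad d ψ t x)) := by
  have hdφ : Differentiable ℝ φ := hφ.differentiable (by norm_num)
  have hd2φ : Differentiable ℝ (fderiv ℝ φ) :=
    (hφ.fderiv_right (m := 1) (by norm_num)).differentiable (by norm_num)
  have hdψ : Differentiable ℝ ψ := hψ.differentiable (by norm_num)
  have hd2ψ : Differentiable ℝ (fderiv ℝ ψ) :=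
    (hψ.fderiv_right (m := 1) (by norm_num)).differentiable (by norm_num)
  have hC : ContDiff ℝ 2 (fun z => c * (φ z + ψ z)) := contDiff_const.mul (hφ.add hψ)
  have h1 : ∀ z, HasFDerivAt (fun z => c * (φ z + ψ z)) (c • (fderiv ℝ φ z + fderiv ℝ ψ z)) z :=
    fun z => ((hdφ z).hasFDerivAt.add (hdψ z).hasFDerivAt).const_mul c
  have h2 : fderiv ℝ (fun z => c * (φ z + ψ z)) = fun z => c • (fderiv ℝ φ z + fderiv ℝ ψ z) := by
    funext z; exact (h1 z).fderiv
  have h3 : ∀ z ξ, fderiv ℝ (fun z => c * (φ z + ψ z)) z ξ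
      = c * (fderiv ℝ φ z ξ + fderiv ℝ ψ z ξ) := by
    intro z ξ
    rw [h2]; simp [mul_add]
  refine ⟨hC, h3, ?_, ?_⟩
  · intro z ξ η
    unfold D2
    rw [h2]
    have h4 : HasFDerivAt (fun z => c • (fderiv ℝ φ z + fderiv ℝ ψ z))
        (c • (fderiv ℝ (fderiv ℝ φ) z + fderiv ℝ (fderiv ℝ ψ) z)) z :=
      ((hd2φ z).hasFDerivAt.add (hd2ψ z).hasFDerivAt).const_smul c
    rw [h4.fderiv]
    simp [mul_add]
  · intro t x
    apply ext_inner_right ℝ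
    intro y
    rw [inner_spaceGrad _ hC, h3, real_inner_smul_left, inner_add_left, inner_spaceGrad _ hφ,
      inner_spaceGrad _ hψ]

/-- the penalisation function -/
def psi (d : ℕ) (κ K1 N t2 : ℝ) : ℝ × Euc d → ℝ := fun z =>
  κ * (Real.sqrt (1 + ‖z.2‖ ^ 2) + K1 * z.1) + Real.exp (N * (z.1 - t2))

lemma psi_calc (d : ℕ) (κ K1 N t2 : ℝ) (hκ : 0 ≤ κ) (hN : 0 ≤ N) :
    ContDiff ℝ 2 (psi d κ K1 N t2) ∧
    (∀ z, κ * K1 ≤ fderiv ℝ (psi d κ K1 N t2) z (1, 0)) ∧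
    (∀ t x, ∃ q : Euc d, ‖q‖ ≤ 1 ∧ spaceGrad d (psi d κ K1 N t2) t x = κ • q) ∧
    (∀ z (ξ : Euc d), D2 d (psi d κ K1 N t2) z (0, ξ) (0, ξ) ≤ κ * ‖ξ‖ ^ 2) := by
  have hC : ContDiff ℝ 2 (psi d κ K1 N t2) := by
    unfold psi
    have h1 : ContDiff ℝ 2 (fun z : ℝ × Euc d => 1 + ‖z.2‖ ^ 2) :=
      contDiff_const.add (contDiff_snd.norm_sq ℝ)
    have h2 : ContDiff ℝ 2 (fun z : ℝ × Euc d => Real.sqrt (1 + ‖z.2‖ ^ 2)) :=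
      h1.sqrt (fun z => by positivity)
    have h3 : ContDiff ℝ 2 (fun z : ℝ × Euc d => z.1) := contDiff_fst
    exact (contDiff_const.mul (h2.add (contDiff_const.mul h3))).add
      ((contDiff_const.mul (h3.sub contDiff_const)).exp)
  -- derivative in space
  have hq : ∀ (x ξ : Euc d) (s : ℝ), HasDerivAt (fun s : ℝ => ‖x + s • ξ‖ ^ 2)
      (2 * ⟪x + s • ξ, ξ⟫) s := by
    intro x ξ s
    have hl : HasDerivAt (fun s : ℝ => x + s • ξ) ξ s := by
      simpa using ((hasDerivAt_id s).smul_const ξ).const_add x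
    exact hl.norm_sq
  have hin : ∀ (x ξ : Euc d) (s : ℝ), HasDerivAt (fun s : ℝ => ⟪x + s • ξ, ξ⟫) (‖ξ‖ ^ 2) s := by
    intro x ξ s
    have hl : HasDerivAt (fun s : ℝ => x + s • ξ) ξ s := by
      simpa using ((hasDerivAt_id s).smul_const ξ).const_add x
    have := hl.inner ℝ (hasDerivAt_const s ξ)
    simpa using this
  have hsq : ∀ (x ξ : Euc d) (s : ℝ), HasDerivAt (fun s : ℝ => Real.sqrt (1 + ‖x + s • ξ‖ ^ 2))
      (⟪x + s • ξ, ξ⟫ / Real.sqrt (1 + ‖x + s • ξ‖ ^ 2)) s := by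
    intro x ξ s
    have := ((hq x ξ s).const_add 1).sqrt (by positivity)
    convert this using 1
    field_simp
  have hsp : ∀ (z : ℝ × Euc d) (ξ : Euc d) (s : ℝ),
      HasDerivAt (fun s : ℝ => psi d κ K1 N t2 (z + s • ((0:ℝ), ξ)))
      (κ * (⟪z.2 + s • ξ, ξ⟫ / Real.sqrt (1 + ‖z.2 + s • ξ‖ ^ 2))) s := by
    intro z ξ s
    have h1 := (((hsq z.2 ξ s).add_const (K1 * z.1)).const_mul κ).add_const
      (Real.exp (N * (z.1 - t2)))
    have e : (fun s : ℝ => psi d κ K1 N t2 (z + s • ((0:ℝ), ξ))) = fun s : ℝ =>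
        κ * (Real.sqrt (1 + ‖z.2 + s • ξ‖ ^ 2) + K1 * z.1) + Real.exp (N * (z.1 - t2)) := by
      funext s
      simp [psi]
    rw [e]
    exact h1
  have hpos : ∀ x : Euc d, 1 ≤ Real.sqrt (1 + ‖x‖ ^ 2) := by
    intro x
    rw [Real.one_le_sqrt]; nlinarith [sq_nonneg ‖x‖]
  refine ⟨hC, ?_, ?_, ?_⟩
  · intro z
    have h1 : ∀ s : ℝ, HasDerivAt (fun s : ℝ => psi d κ K1 N t2 (z + s • ((1:ℝ), (0 : Euc d))))
        (κ * K1 + N * Real.exp (N * (z.1 + s - t2))) s := by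
      intro s
      have e0 : HasDerivAt (fun s : ℝ => z.1 + s) 1 s := (hasDerivAt_id s).const_add z.1
      have h1 := (((e0.const_mul K1).const_add (Real.sqrt (1 + ‖z.2‖ ^ 2))).const_mul κ).add
        (((e0.sub_const t2).const_mul N).exp)
      have e : (fun s : ℝ => psi d κ K1 N t2 (z + s • ((1:ℝ), (0 : Euc d)))) = fun s : ℝ =>
          κ * (Real.sqrt (1 + ‖z.2‖ ^ 2) + K1 * (z.1 + s)) + Real.exp (N * (z.1 + s - t2)) := by
        funext s
        simp [psi]
      rw [e]
      refine h1.congr_deriv ?_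
      ring
    rw [(dir_deriv _ hC z _ _ h1).1]
    have : 0 ≤ N * Real.exp (N * (z.1 + 0 - t2)) := by positivity
    linarith
  · intro t x
    refine ⟨(Real.sqrt (1 + ‖x‖ ^ 2))⁻¹ • x, ?_, ?_⟩
    · rw [norm_smul, norm_inv, Real.norm_eq_abs, abs_of_nonneg (Real.sqrt_nonneg _),
        inv_mul_le_iff₀ (by linarith [hpos x]), mul_one]
      apply Real.le_sqrt_of_sq_le
      linarith
    · apply ext_inner_right ℝ
      intro y
      rw [inner_spaceGrad _ hC, (dir_deriv _ hC (t, x) _ _ (hsp (t, x) y)).1]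
      simp only [zero_smul, add_zero, real_inner_smul_left]
      field_simp
  · intro z ξ
    have h1 := (hin z.2 ξ 0).div (hsq z.2 ξ 0) (by
      have := hpos (z.2 + (0:ℝ) • ξ); positivity)
    rw [(dir_deriv _ hC z _ _ (hsp z ξ)).2 _ (h1.const_mul κ)]
    apply mul_le_mul_of_nonneg_left _ hκ
    simp only [zero_smul, add_zero]
    have hp := hpos z.2
    set S := Real.sqrt (1 + ‖z.2‖ ^ 2)
    have h2 : (‖ξ‖ ^ 2 * S - ⟪z.2, ξ⟫ * (⟪z.2, ξ⟫ / S)) / S ^ 2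
        = ‖ξ‖ ^ 2 / S - ⟪z.2, ξ⟫ ^ 2 / S ^ 3 := by field_simp
    rw [h2]
    have h3 : 0 ≤ ⟪z.2, ξ⟫ ^ 2 / S ^ 3 := by positivity
    have h4 : ‖ξ‖ ^ 2 / S ≤ ‖ξ‖ ^ 2 := div_le_self (by positivity) hp
    linarith

/-- quadratic test functions -/
lemma quad_calc {d : ℕ} (z0 P : WithLp 2 (ℝ × Euc d))
    (L : WithLp 2 (ℝ × Euc d) →L[ℝ] WithLp 2 (ℝ × Euc d)) (ν : ℝ) :
    let φ : ℝ × Euc d → ℝ := fun z => ⟪P, WithLp.toLp 2 z - z0⟫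
      + (1 / 2) * ⟪L (WithLp.toLp 2 z - z0), WithLp.toLp 2 z - z0⟫
      + ν * ‖WithLp.toLp 2 z - z0‖ ^ 2
    ContDiff ℝ 2 φ ∧ fderiv ℝ φ (z0.fst, z0.snd) (1, 0) = P.fst ∧
      spaceGrad d φ z0.fst z0.snd = P.snd ∧
      ∀ ξ : Euc d, D2 d φ (z0.fst, z0.snd) (0, ξ) (0, ξ) =
        ⟪L (WithLp.toLp 2 (0, ξ)), WithLp.toLp 2 (0, ξ)⟫ + 2 * ν * ‖ξ‖ ^ 2 := by
  intro φ
  let e : (ℝ × Euc d) →L[ℝ] WithLp 2 (ℝ × Euc d) :=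
    ((WithLp.prodContinuousLinearEquiv 2 ℝ ℝ (Euc d)).symm :
      (ℝ × Euc d) →L[ℝ] WithLp 2 (ℝ × Euc d))
  have he : ∀ z, WithLp.toLp 2 z = e z := fun z => rfl
  have hC : ContDiff ℝ 2 φ := by
    have h1 : ContDiff ℝ 2 (fun z : ℝ × Euc d => (WithLp.toLp 2 z - z0 : WithLp 2 (ℝ × Euc d))) := by
      simp only [he]
      exact e.contDiff.sub contDiff_const
    have h2 := L.contDiff.comp h1 (n := 2)
    exact ((contDiff_const.inner ℝ h1).add (contDiff_const.mul (h2.inner ℝ h1))).add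
      (contDiff_const.mul (h1.norm_sq ℝ))
  have hz0 : e (z0.fst, z0.snd) = z0 := rfl
  have key : ∀ ξ : ℝ × Euc d, fderiv ℝ φ (z0.fst, z0.snd) ξ = ⟪P, e ξ⟫ ∧
      D2 d φ (z0.fst, z0.snd) ξ ξ = ⟪L (e ξ), e ξ⟫ + 2 * ν * ‖e ξ‖ ^ 2 := by
    intro ξ
    have h1 : (fun s : ℝ => φ ((z0.fst, z0.snd) + s • ξ)) = fun s : ℝ =>
        s * ⟪P, e ξ⟫ + s ^ 2 * ((1 / 2) * ⟪L (e ξ), e ξ⟫ + ν * ‖e ξ‖ ^ 2) := by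
      funext s
      simp only [φ, he, map_add, map_smul, hz0, add_sub_cancel_left, inner_smul_right,
        real_inner_smul_left, norm_smul, Real.norm_eq_abs, mul_pow, sq_abs]
      ring
    have h2 : ∀ s : ℝ, HasDerivAt (fun s : ℝ => φ ((z0.fst, z0.snd) + s • ξ))
        (⟪P, e ξ⟫ + s * (⟪L (e ξ), e ξ⟫ + 2 * ν * ‖e ξ‖ ^ 2)) s := by
      intro s
      rw [h1]
      have h3 := ((hasDerivAt_id s).mul_const ⟪P, e ξ⟫).add
        (((hasDerivAt_id s).pow 2).mul_const ((1 / 2) * ⟪L (e ξ), e ξ⟫ + ν * ‖e ξ‖ ^ 2))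
      refine h3.congr_deriv ?_
      simp; ring
    have h4 := dir_deriv φ hC (z0.fst, z0.snd) ξ _ h2
    refine ⟨by rw [h4.1]; ring, h4.2 _ ?_⟩
    have h5 := ((hasDerivAt_id (0:ℝ)).mul_const (⟪L (e ξ), e ξ⟫ + 2 * ν * ‖e ξ‖ ^ 2)).const_add
      ⟪P, e ξ⟫
    simpa using h5
  have hinn : ∀ z z' : WithLp 2 (ℝ × Euc d), ⟪z, z'⟫ = ⟪z.fst, z'.fst⟫ + ⟪z.snd, z'.snd⟫ :=
    fun z z' => WithLp.prod_inner_apply z z'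
  refine ⟨hC, ?_, ?_, ?_⟩
  · rw [(key _).1, hinn]
    have h1 : (e (1, 0)).fst = (1:ℝ) := rfl
    have h2 : (e (1, 0)).snd = (0 : Euc d) := rfl
    rw [h1, h2]; simp
  · apply ext_inner_right ℝ
    intro y
    rw [inner_spaceGrad _ hC, (key _).1, hinn]
    have h1 : (e (0, y)).fst = (0:ℝ) := rfl
    have h2 : (e (0, y)).snd = y := rfl
    rw [h1, h2]; simp
  · intro ξ
    rw [(key _).2]
    have h3 : ‖e (0, ξ)‖ ^ 2 = ‖ξ‖ ^ 2 := by
      have h1 : (e (0, ξ)).fst = (0:ℝ) := rfl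
      have h2 : (e (0, ξ)).snd = ξ := rfl
      rw [WithLp.prod_norm_sq_eq_of_L2, h1, h2]; simp
    rw [h3]
    rfl

end Calc2

section Ham

open Topology

variable {d : ℕ} {m Λ : ℝ} {a M : ℝ → ℝ} {H : Euc d → Euc d → ℝ} {ρ : ℝ} {I : Type}
  {mi : I → ℝ} {Hi : I → Euc d → Euc d → ℝ}

lemma Hi_bdd (haM : GoodFamilies a M) (hHi : ∀ i, MemB d (mi i) Λ a M (Hi i)) (x p : Euc d) :
    BddBelow (range fun i => Hi i x p) := by
  have hr : 0 < ‖x‖ + 1 := by positivity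
  refine ⟨- M (‖x‖ + 1), ?_⟩
  rintro _ ⟨i, rfl⟩
  have h1 := ((hHi i).2.2.2 (‖x‖ + 1) hr x (by simp) p).1
  have h2 : 0 ≤ a (‖x‖ + 1) * ‖p‖ ^ (mi i) :=
    mul_nonneg (haM _ hr).1.1.le (Real.rpow_nonneg (norm_nonneg _) _)
  simp only
  linarith

lemma H_le_Hi (haM : GoodFamilies a M) (hHi : ∀ i, MemB d (mi i) Λ a M (Hi i))
    (hinf : ∀ x p : Euc d, ρ ≤ ‖p‖ → H x p = ⨅ i, Hi i x p) (x p : Euc d) (hp : ρ ≤ ‖p‖) (i : I) :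
    H x p ≤ Hi i x p := by
  rw [hinf x p hp]
  exact ciInf_le (Hi_bdd haM hHi x p) i

lemma H_small (hm : 1 < m) (hΛ : 0 < Λ) (hH : MemH d m Λ a M H) (B : ℝ) (hB : 0 ≤ B) :
    ∃ K, 0 ≤ K ∧ ∀ (x p q : Euc d) (l : ℝ), ‖p‖ ≤ B → ‖q‖ ≤ 1 → 0 ≤ l → l ≤ 1 →
      H x (l • p + (1 - l) • q) ≤ l * H x p + (1 - l) * K := by
  refine ⟨Λ * (2 * B + 2) ^ (m - 1) * (B + 1) + Λ * (B ^ m + 1), by positivity, ?_⟩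
  intro x p q l hp hq hl0 hl1
  have h1 := (abs_le.1 (hH.1 x (l • p + (1 - l) • q) p)).2
  have e1 : l • p + (1 - l) • q - p = (1 - l) • (q - p) := by module
  have n1 : ‖l • p + (1 - l) • q‖ ≤ B + 1 := by
    refine (norm_add_le _ _).trans ?_
    rw [norm_smul, norm_smul, Real.norm_of_nonneg hl0, Real.norm_of_nonneg (by linarith)]
    nlinarith [norm_nonneg p, norm_nonneg q]
  have n2 : ‖q - p‖ ≤ B + 1 := (norm_sub_le _ _).trans (by linarith)
  rw [e1, norm_smul, Real.norm_of_nonneg (by linarith)] at h1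
  have h2 : (‖l • p + (1 - l) • q‖ + ‖p‖ + 1) ^ (m - 1) ≤ (2 * B + 2) ^ (m - 1) :=
    Real.rpow_le_rpow (by positivity) (by linarith) (by linarith)
  have h3 : Λ * (‖l • p + (1 - l) • q‖ + ‖p‖ + 1) ^ (m - 1) * ((1 - l) * ‖q - p‖) ≤
      Λ * (2 * B + 2) ^ (m - 1) * ((1 - l) * (B + 1)) := by
    gcongr
  have h4 := ((hH.2 (‖x‖ + 1) (by positivity)).1 x (by simp) p).2
  have h5 : ‖p‖ ^ m ≤ B ^ m := Real.rpow_le_rpow (norm_nonneg _) hp (by linarith)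
  have h6 : H x p ≤ Λ * (B ^ m + 1) := h4.trans (by gcongr)
  have h7 : (1 - l) * H x p ≤ (1 - l) * (Λ * (B ^ m + 1)) :=
    mul_le_mul_of_nonneg_left h6 (by linarith)
  linarith

lemma H_quasi (hm : 1 < m) (hΛ : 0 < Λ) (haM : GoodFamilies a M) (hH : MemH d m Λ a M H)
    (hρ : 0 < ρ) (hI : Nonempty I) (hmi : ∀ i, 1 < mi i)
    (hHi : ∀ i, MemB d (mi i) Λ a M (Hi i))
    (hinf : ∀ x p : Euc d, ρ ≤ ‖p‖ → H x p = ⨅ i, Hi i x p) :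
    ∃ K, 0 ≤ K ∧ ∀ (x p q : Euc d) (l : ℝ), ‖q‖ ≤ 1 → 1 / 2 ≤ l → l ≤ 1 →
      H x (l • p + (1 - l) • q) ≤ l * H x p + (1 - l) * K := by
  obtain ⟨K, hK0, hK⟩ := H_small hm hΛ hH (2 * ρ + 2) (by positivity)
  refine ⟨max K (2 * Λ), by positivity, fun x p q l hq hl0 hl1 => ?_⟩
  by_cases hp : ‖p‖ ≤ 2 * ρ + 2
  · have h1 := hK x p q l hp hq (by linarith) hl1
    have h2 : (1 - l) * K ≤ (1 - l) * max K (2 * Λ) :=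
      mul_le_mul_of_nonneg_left (le_max_left _ _) (by linarith)
    linarith
  · push Not at hp
    have n1 : ρ ≤ ‖l • p + (1 - l) • q‖ := by
      have h1 := norm_sub_le_norm_add (l • p) ((1 - l) • q)
      rw [norm_smul, norm_smul, Real.norm_of_nonneg (by linarith : 0 ≤ l),
        Real.norm_of_nonneg (by linarith : 0 ≤ 1 - l)] at h1
      nlinarith [norm_nonneg q, norm_nonneg p]
    have h2 : ∀ i, (H x (l • p + (1 - l) • q) - (1 - l) * (2 * Λ)) / l ≤ Hi i x p := by
      intro i
      rw [div_le_iff₀ (by linarith)]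
      have h3 := H_le_Hi haM hHi hinf x _ n1 i
      have h4 := ((hHi i).2.1 x).2 (mem_univ p) (mem_univ q) (by linarith : 0 ≤ l)
        (by linarith : 0 ≤ 1 - l) (by ring)
      simp only [smul_eq_mul] at h4
      have h5 := ((hHi i).2.2.2 (‖x‖ + 1) (by positivity) x (by simp) q).2
      have h6 : ‖q‖ ^ (mi i) ≤ 1 :=
        Real.rpow_le_one (norm_nonneg _) hq (by linarith [hmi i])
      have h7 : Hi i x q ≤ 2 * Λ := h5.trans (by nlinarith)
      have h8 : (1 - l) * Hi i x q ≤ (1 - l) * (2 * Λ) :=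
        mul_le_mul_of_nonneg_left h7 (by linarith)
      linarith
    have h9 := le_ciInf h2
    rw [← hinf x p (by linarith), div_le_iff₀ (by linarith)] at h9
    have h10 : (1 - l) * (2 * Λ) ≤ (1 - l) * max K (2 * Λ) :=
      mul_le_mul_of_nonneg_left (le_max_right _ _) (by linarith)
    linarith

lemma m_le_mi (hd : 0 < d) (hΛ : 0 < Λ) (haM : GoodFamilies a M)
    (hH : MemH d m Λ a M H)
    (hmi : ∀ i, 1 < mi i)
    (hHi : ∀ i, MemB d (mi i) Λ a M (Hi i))
    (hinf : ∀ x p : Euc d, ρ ≤ ‖p‖ → H x p = ⨅ i, Hi i x p) (i : I) : m ≤ mi i := by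
  by_contra! hlt
  have ha := (haM 1 one_pos).1.1
  have hM := (haM 1 one_pos).2
  have ht := tendsto_rpow_atTop (sub_pos.2 hlt)
  obtain ⟨s, hs1, hs2, hs3⟩ := ((ht.eventually_gt_atTop ((2 * Λ + M 1) / a 1)).and
    ((eventually_ge_atTop 1).and (eventually_ge_atTop ρ))).exists
  have hs0 : 0 < s := by linarith
  set p : Euc d := EuclideanSpace.single ⟨0, hd⟩ s
  have hp : ‖p‖ = s := by simp [p, abs_of_pos hs0]
  have h1 := H_le_Hi haM hHi hinf 0 p (by rw [hp]; exact hs3) i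
  have h2 := ((hHi i).2.2.2 1 one_pos 0 (by simp) p).2
  have h3 := ((hH.2 1 one_pos).1 0 (by simp) p).1
  rw [hp] at h2 h3
  have h4 : s ^ m = s ^ (m - mi i) * s ^ (mi i) := by
    rw [← Real.rpow_add hs0]; ring_nf
  have h5 : 1 ≤ s ^ (mi i) := Real.one_le_rpow hs2 (by linarith [hmi i])
  rw [div_lt_iff₀ ha] at hs1
  have h6 : (2 * Λ + M 1) * s ^ (mi i) < a 1 * s ^ m := by
    rw [h4]
    nlinarith
  nlinarith

lemma H_strict (hd : 0 < d) (hm : 1 < m) (hΛ : 0 < Λ) (haM : GoodFamilies a M)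
    (hH : MemH d m Λ a M H)
    (hρ : 0 < ρ) (hI : Nonempty I) (hmi : ∀ i, 1 < mi i)
    (hHi : ∀ i, MemB d (mi i) Λ a M (Hi i))
    (hinf : ∀ x p : Euc d, ρ ≤ ‖p‖ → H x p = ⨅ i, Hi i x p) (r : ℝ) (hr : 0 < r) :
    ∃ κ C, 0 < κ ∧ 0 ≤ C ∧ ∀ x ∈ ball (0 : Euc d) r, ∀ (p : Euc d) (μ : ℝ), 1 / 2 ≤ μ → μ ≤ 1 →
      H x (μ • p) ≤ μ * H x p - (1 - μ) * (κ * ‖p‖ ^ m - C) := by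
  obtain ⟨K, hK0, hK⟩ := H_small hm hΛ hH (2 * ρ) (by positivity)
  have ha := (haM r hr).1.1
  have hM := (haM r hr).2
  obtain ⟨θ, hθ0, hθ1, hθ2⟩ : ∃ θ : ℝ, 0 < θ ∧ θ ≤ 1 / 2 ∧ Λ * θ ^ m / a r ≤ θ / 2 := by
    have ht : Tendsto (fun θ : ℝ => θ ^ (m - 1)) (𝓝[>] 0) (𝓝 0) := by
      have h1 := (Real.continuous_rpow_const (q := m - 1) (by linarith)).tendsto 0
      rw [Real.zero_rpow (by linarith)] at h1
      exact h1.mono_left nhdsWithin_le_nhds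
    have h2 := ht.eventually (gt_mem_nhds (show 0 < a r / (2 * Λ) by positivity))
    have h3 : ∀ᶠ θ : ℝ in 𝓝[>] 0, θ < 1 / 2 :=
      nhdsWithin_le_nhds (gt_mem_nhds (by norm_num))
    obtain ⟨θ, hθ, hθ1, hθ2⟩ := (h2.and (h3.and self_mem_nhdsWithin)).exists
    have hθ2 : 0 < θ := hθ2
    refine ⟨θ, hθ2, hθ1.le, ?_⟩
    have h4 : θ ^ m = θ ^ (m - 1) * θ := by
      conv_rhs => rw [← Real.rpow_one θ, ← Real.rpow_mul hθ2.le]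
      rw [← Real.rpow_add hθ2]; ring_nf
    rw [h4, div_le_iff₀ ha]
    rw [lt_div_iff₀ (by positivity)] at hθ
    nlinarith
  refine ⟨θ * a r / 2, max (K + θ * a r / 2 * (2 * ρ) ^ m) (2 * (2 * M r + Λ)), by positivity,
    by positivity, ?_⟩
  intro x hx p μ hμ0 hμ1
  set C := max (K + θ * a r / 2 * (2 * ρ) ^ m) (2 * (2 * M r + Λ)) with hC
  by_cases hp : ‖p‖ ≤ 2 * ρ
  · have h1 := hK x p 0 μ hp (by simp) (by linarith) hμ1
    rw [smul_zero, add_zero] at h1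
    have h2 : ‖p‖ ^ m ≤ (2 * ρ) ^ m := Real.rpow_le_rpow (norm_nonneg _) hp (by linarith)
    have h3 : K ≤ - (θ * a r / 2 * ‖p‖ ^ m - C) := by
      have h4 : θ * a r / 2 * ‖p‖ ^ m ≤ θ * a r / 2 * (2 * ρ) ^ m := by gcongr
      have h5 := le_max_left (K + θ * a r / 2 * (2 * ρ) ^ m) (2 * (2 * M r + Λ))
      linarith
    have h4 := mul_le_mul_of_nonneg_left h3 (by linarith : 0 ≤ 1 - μ)
    linarith
  · push Not at hp
    have n1 : ρ ≤ ‖μ • p‖ := by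
      rw [norm_smul, Real.norm_of_nonneg (by linarith)]
      nlinarith
    set l := (μ - θ) / (1 - θ) with hl
    have hl0 : 0 ≤ l := div_nonneg (by linarith) (by linarith)
    have hl1 : 1 - l = (1 - μ) / (1 - θ) := by
      rw [hl]; field_simp [show (1 - θ) ≠ 0 by linarith]; ring
    have hl2 : 0 ≤ 1 - l := by rw [hl1]; exact div_nonneg (by linarith) (by linarith)
    have hl3 : 1 - μ ≤ 1 - l := by
      rw [hl1, le_div_iff₀ (by linarith)]; nlinarith
    have hl4 : 1 - l ≤ 2 * (1 - μ) := by
      rw [hl1, div_le_iff₀ (by linarith)]; nlinarith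
    have hμl : μ = l + (1 - l) * θ := by
      rw [hl1, hl]; field_simp [show (1 - θ) ≠ 0 by linarith]; ring
    have e1 : μ • p = l • p + (1 - l) • (θ • p) := by
      conv_lhs => rw [hμl]
      module
    have hco : 0 < l + (1 - l) * (θ / 2) := by nlinarith
    have h2 : ∀ i, (H x (μ • p) - (1 - l) * (θ / 2 * M r + Λ)) / (l + (1 - l) * (θ / 2))
        ≤ Hi i x p := by
      intro i
      rw [div_le_iff₀ hco]
      have h3 := H_le_Hi haM hHi hinf x _ n1 i
      have h4 := ((hHi i).2.1 x).2 (mem_univ p) (mem_univ (θ • p)) hl0 hl2 (by ring)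
      rw [← e1] at h4
      simp only [smul_eq_mul] at h4
      have h5 := ((hHi i).2.2.2 r hr x hx (θ • p)).2
      have h6 := ((hHi i).2.2.2 r hr x hx p).1
      rw [norm_smul, Real.norm_of_nonneg hθ0.le, Real.mul_rpow hθ0.le (norm_nonneg _)] at h5
      have h7 : θ ^ (mi i) ≤ θ ^ m := Real.rpow_le_rpow_of_exponent_ge hθ0 (by linarith)
        (m_le_mi hd hΛ haM hH hmi hHi hinf i)
      have h8 : 0 ≤ ‖p‖ ^ (mi i) := Real.rpow_nonneg (norm_nonneg _) _
      have h9 : Hi i x (θ • p) ≤ θ / 2 * (Hi i x p + M r) + Λ := by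
        have q1 : Λ * (θ ^ (mi i) * ‖p‖ ^ (mi i)) ≤ Λ * (θ ^ m * ‖p‖ ^ (mi i)) := by gcongr
        have q2 : Λ * (θ ^ m * ‖p‖ ^ (mi i)) = (Λ * θ ^ m / a r) * (a r * ‖p‖ ^ (mi i)) := by
          field_simp
        have q3 : (Λ * θ ^ m / a r) * (a r * ‖p‖ ^ (mi i)) ≤ θ / 2 * (a r * ‖p‖ ^ (mi i)) := by
          gcongr
        have q4 : θ / 2 * (a r * ‖p‖ ^ (mi i)) ≤ θ / 2 * (Hi i x p + M r) := by
          gcongr; linarith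
        linarith
      have h10 := mul_le_mul_of_nonneg_left h9 hl2
      linarith
    have h9 := le_ciInf h2
    rw [← hinf x p (by linarith), div_le_iff₀ hco] at h9
    have h10 := ((hH.2 r hr).1 x hx p).1
    have h11 : 0 ≤ ‖p‖ ^ m := Real.rpow_nonneg (norm_nonneg _) _
    have h12 : H x p * (l + (1 - l) * (θ / 2)) = μ * H x p - (1 - l) * (θ / 2) * H x p := by
      conv_rhs => rw [hμl]
      ring
    have h13 : (1 - l) * (θ / 2) * (a r * ‖p‖ ^ m - M r) ≤ (1 - l) * (θ / 2) * H x p :=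
      mul_le_mul_of_nonneg_left h10 (by positivity)
    have h14 : (1 - μ) * (θ * a r / 2 * ‖p‖ ^ m) ≤ (1 - l) * (θ * a r / 2 * ‖p‖ ^ m) :=
      mul_le_mul_of_nonneg_right hl3 (by positivity)
    have h15 : (1 - l) * (θ * M r + Λ) ≤ (1 - l) * (2 * M r + Λ) := by
      apply mul_le_mul_of_nonneg_left _ hl2
      nlinarith
    have h16 : (1 - l) * (2 * M r + Λ) ≤ 2 * (1 - μ) * (2 * M r + Λ) :=
      mul_le_mul_of_nonneg_right hl4 (by positivity)
    have h17 : (1 - μ) * (2 * (2 * M r + Λ)) ≤ (1 - μ) * C :=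
      mul_le_mul_of_nonneg_left (le_max_right _ _) (by linarith)
    linarith

end Ham

section Visc1

open Topology

lemma nhds_aux {d : ℕ} {T T' : ℝ} {U U' : Set (Euc d)} (hU' : IsOpen U')
    {t : ℝ} (ht : t ∈ Ioo 0 T') {x : Euc d} (hx : x ∈ U') :
    𝓝[Ioo 0 T ×ˢ U] (t, x) ≤ 𝓝[Ioo 0 T' ×ˢ U'] (t, x) := by
  have h1 : IsOpen (Ioo 0 T' ×ˢ U') := isOpen_Ioo.prod hU'
  rw [h1.nhdsWithin_eq ⟨ht, hx⟩]
  exact nhdsWithin_le_nhds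

lemma sub_restrict {d : ℕ} {A : Euc d → Matrix (Fin d) (Fin d) ℝ} {H : Euc d → Euc d → ℝ}
    {T T' : ℝ} {U U' : Set (Euc d)} {v v' : ℝ × Euc d → ℝ} (hT : T' ≤ T) (hU' : IsOpen U')
    (hUU : U' ⊆ U) (hvv : ∀ z ∈ Ioo 0 T' ×ˢ U', v' z = v z)
    (h : IsViscSubsolution d A H T U v) : IsViscSubsolution d A H T' U' v' := by
  intro φ hφ t ht x hx hmax
  refine h φ hφ t ⟨ht.1, ht.2.trans_le hT⟩ x (hUU hx) ?_
  have h1 : ∀ᶠ z in 𝓝[Ioo 0 T' ×ˢ U'] (t, x), v z - φ z ≤ v (t, x) - φ (t, x) := by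
    have h2 : ∀ᶠ z in 𝓝[Ioo 0 T' ×ˢ U'] (t, x), v' z - φ z ≤ v' (t, x) - φ (t, x) := hmax
    filter_upwards [h2, self_mem_nhdsWithin] with z hz hz'
    rwa [hvv z hz', hvv (t, x) ⟨ht, hx⟩] at hz
  exact nhds_aux hU' ht hx h1

lemma sup_restrict {d : ℕ} {A : Euc d → Matrix (Fin d) (Fin d) ℝ} {H : Euc d → Euc d → ℝ}
    {T T' : ℝ} {U U' : Set (Euc d)} {v v' : ℝ × Euc d → ℝ} (hT : T' ≤ T) (hU' : IsOpen U')
    (hUU : U' ⊆ U) (hvv : ∀ z ∈ Ioo 0 T' ×ˢ U', v' z = v z)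
    (h : IsViscSupersolution d A H T U v) : IsViscSupersolution d A H T' U' v' := by
  intro φ hφ t ht x hx hmax
  refine h φ hφ t ⟨ht.1, ht.2.trans_le hT⟩ x (hUU hx) ?_
  have h1 : ∀ᶠ z in 𝓝[Ioo 0 T' ×ˢ U'] (t, x), v (t, x) - φ (t, x) ≤ v z - φ z := by
    have h2 : ∀ᶠ z in 𝓝[Ioo 0 T' ×ˢ U'] (t, x), v' (t, x) - φ (t, x) ≤ v' z - φ z := hmax
    filter_upwards [h2, self_mem_nhdsWithin] with z hz hz'
    rwa [hvv z hz', hvv (t, x) ⟨ht, hx⟩] at hz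
  exact nhds_aux hU' ht hx h1

lemma stage1 {d : ℕ} {A : Euc d → Matrix (Fin d) (Fin d) ℝ} {H : Euc d → Euc d → ℝ} {ΛA : ℝ}
    (hΛA : 0 < ΛA) (hA : CondA d ΛA A) (K : ℝ)
    (hK : ∀ (x p q : Euc d) (l : ℝ), ‖q‖ ≤ 1 → 1 / 2 ≤ l → l ≤ 1 →
      H x (l • p + (1 - l) • q) ≤ l * H x p + (1 - l) * K)
    {T : ℝ} {U : Set (Euc d)} {v : ℝ × Euc d → ℝ} (h : IsViscSubsolution d A H T U v)
    (l N t2 : ℝ) (hl0 : 1 / 2 ≤ l) (hl1 : l ≤ 1) (hN : 0 ≤ N) :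
    IsViscSubsolution d A (fun x p => H x p + (1 - l)) T U
      (fun z => l * v z - psi d (1 - l) (K + ΛA ^ 2 + 1) N t2 z) := by
  obtain ⟨n, σ, hAσ, hσ1, hσ2⟩ := hA
  intro φ hφ t ht x hx hmax
  set K1 := K + ΛA ^ 2 + 1 with hK1
  set ψ := psi d (1 - l) K1 N t2 with hψdef
  obtain ⟨hψ, hψt, hψx, hψ2⟩ := psi_calc d (1 - l) K1 N t2 (by linarith) hN
  rw [← hψdef] at hψ hψt hψx hψ2
  obtain ⟨c1, c2, c3, c4⟩ := comb_calc φ ψ hφ hψ (1 / l)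
  have hl : 0 < l := by linarith
  have h1 := h _ c1 t ht x hx (by
    have h2 : ∀ᶠ z in 𝓝[Ioo 0 T ×ˢ U] (t, x), (l * v z - ψ z) - φ z ≤
      (l * v (t, x) - ψ (t, x)) - φ (t, x) := hmax
    have h3 : ∀ᶠ z in 𝓝[Ioo 0 T ×ˢ U] (t, x), v z - 1 / l * (φ z + ψ z) ≤
        v (t, x) - 1 / l * (φ (t, x) + ψ (t, x)) := by
      filter_upwards [h2] with z hz
      have e : ∀ z, v z - 1 / l * (φ z + ψ z) = (l * v z - ψ z - φ z) / l := by
        intro z; field_simp; ring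
      rw [e, e]
      gcongr
    exact h3)
  rw [op_eq A σ hAσ _ _ c1, c2, c4] at h1
  simp only [c3] at h1
  rw [op_eq A σ hAσ _ _ hφ]
  obtain ⟨q, hq, hqe⟩ := hψx t x
  rw [hqe] at h1
  have h3 := hK x ((1 / l) • (spaceGrad d φ t x + (1 - l) • q)) (-q) l (by rwa [norm_neg]) hl0 hl1
  have e1 : l • (1 / l) • (spaceGrad d φ t x + (1 - l) • q) + (1 - l) • -q
      = spaceGrad d φ t x := by
    rw [smul_smul, mul_one_div_cancel hl.ne', one_smul, smul_neg, add_neg_cancel_right]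
  rw [e1] at h3
  have h4 := hψt (t, x)
  have h5 : ∑ k, D2 d ψ (t, x) (0, colv (σ x) k) (0, colv (σ x) k) ≤ (1 - l) * ΛA ^ 2 := by
    calc _ ≤ ∑ k, (1 - l) * ‖colv (σ x) k‖ ^ 2 := Finset.sum_le_sum fun k _ => hψ2 _ _
      _ = (1 - l) * matFrobNorm (σ x) ^ 2 := by rw [← Finset.mul_sum, sum_colv]
      _ ≤ _ := by
        have h6 : 0 ≤ matFrobNorm (σ x) := Real.sqrt_nonneg _
        have h7 := hσ1 x
        have h8 : 0 ≤ 1 - l := by linarith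
        gcongr
  rw [← Finset.mul_sum, Finset.sum_add_distrib] at h1
  have h6 := mul_nonpos_of_nonneg_of_nonpos hl.le h1
  have e2 : ∀ X Y Z : ℝ, l * (1 / l * X - 1 / l * Y + Z) = X - Y + l * Z := by
    intro X Y Z; field_simp
  rw [e2] at h6
  nlinarith

lemma stage2 {d : ℕ} {A : Euc d → Matrix (Fin d) (Fin d) ℝ} {H : Euc d → Euc d → ℝ} {ΛA : ℝ}
    (hA : CondA d ΛA A) (m κ C r : ℝ) (hm : 0 ≤ m) (hκ : 0 ≤ κ)
    (hH : ∀ x ∈ ball (0 : Euc d) r, ∀ (p : Euc d) (μ : ℝ), 1 / 2 ≤ μ → μ ≤ 1 →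
      H x (μ • p) ≤ μ * H x p - (1 - μ) * (κ * ‖p‖ ^ m - C))
    {T : ℝ} {U : Set (Euc d)} (hU : U ⊆ ball 0 r) {v : ℝ × Euc d → ℝ} (γ : ℝ)
    (h : IsViscSubsolution d A (fun x p => H x p + γ) T U v)
    (μ γ' : ℝ) (hμ0 : 1 / 2 ≤ μ) (hμ1 : μ ≤ 1) (hγ : γ' ≤ μ * γ - (1 - μ) * C) :
    IsViscSubsolution d A (fun x p => H x p + (1 - μ) * κ * ‖p‖ ^ m + γ') T U
      (fun z => μ * v z) := by
  obtain ⟨n, σ, hAσ, hσ1, hσ2⟩ := hA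
  intro φ hφ t ht x hx hmax
  have h0 : ContDiff ℝ 2 (fun _ : ℝ × Euc d => (0:ℝ)) := contDiff_const
  obtain ⟨c1, c2, c3, c4⟩ := comb_calc φ (fun _ => 0) hφ h0 (1 / μ)
  have hμ : 0 < μ := by linarith
  have h1 := h _ c1 t ht x hx (by
    have h2 : ∀ᶠ z in 𝓝[Ioo 0 T ×ˢ U] (t, x), μ * v z - φ z ≤
      μ * v (t, x) - φ (t, x) := hmax
    have h3 : ∀ᶠ z in 𝓝[Ioo 0 T ×ˢ U] (t, x), v z - 1 / μ * (φ z + 0) ≤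
        v (t, x) - 1 / μ * (φ (t, x) + 0) := by
      filter_upwards [h2] with z hz
      have e : ∀ z, v z - 1 / μ * (φ z + 0) = (μ * v z - φ z) / μ := by
        intro z; field_simp; ring
      rw [e, e]
      gcongr
    exact h3)
  rw [op_eq A σ hAσ _ _ c1, c2, c4] at h1
  simp only [c3] at h1
  rw [op_eq A σ hAσ _ _ hφ]
  have z1 : ∀ z ξ, fderiv ℝ (fun _ : ℝ × Euc d => (0:ℝ)) z ξ = 0 := by
    intro z ξ; simp
  have z2 : ∀ z ξ η, D2 d (fun _ : ℝ × Euc d => (0:ℝ)) z ξ η = 0 := by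
    intro z ξ η; simp [D2]
  have z3 : spaceGrad d (fun _ : ℝ × Euc d => (0:ℝ)) t x = 0 := by
    apply ext_inner_right ℝ
    intro y
    rw [inner_spaceGrad _ h0, z1, inner_zero_left]
  simp only [z1, z2, z3, add_zero] at h1
  set P := spaceGrad d φ t x
  have h3 := hH x (hU hx) ((1 / μ) • P) μ hμ0 hμ1
  rw [smul_smul, mul_one_div_cancel hμ.ne', one_smul] at h3
  have h4 : ‖P‖ ^ m ≤ ‖(1 / μ) • P‖ ^ m := by
    apply Real.rpow_le_rpow (norm_nonneg _) _ hm
    rw [norm_smul, Real.norm_of_nonneg (by positivity)]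
    have : 1 ≤ 1 / μ := by rw [le_div_iff₀ hμ]; linarith
    nlinarith [norm_nonneg P]
  have h5 : (1 - μ) * κ * ‖P‖ ^ m ≤ (1 - μ) * κ * ‖(1 / μ) • P‖ ^ m := by
    have : 0 ≤ 1 - μ := by linarith
    gcongr
  rw [← Finset.mul_sum] at h1
  have h6 := mul_nonpos_of_nonneg_of_nonpos hμ.le h1
  have e2 : ∀ X Y Z : ℝ, μ * (1 / μ * X - 1 / μ * Y + Z) = X - Y + μ * Z := by
    intro X Y Z; field_simp
  rw [e2] at h6
  linarith

end Visc1

section Visc2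

open Topology

lemma toLp_tendsto {d : ℕ} (z0 : WithLp 2 (ℝ × Euc d)) (r : ℝ) (hr : 0 < r) :
    ∀ᶠ z in 𝓝 (z0.fst, z0.snd), ‖(WithLp.toLp 2 z - z0 : WithLp 2 (ℝ × Euc d))‖ < r := by
  have h1 : Continuous (fun z : ℝ × Euc d => ‖(WithLp.toLp 2 z - z0 : WithLp 2 (ℝ × Euc d))‖) := by
    have h2 : Continuous (fun z : ℝ × Euc d => (WithLp.toLp 2 z : WithLp 2 (ℝ × Euc d))) :=
      WithLp.prod_continuous_toLp 2 ℝ (Euc d)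
    exact (h2.sub continuous_const).norm
  have h3 := h1.tendsto (z0.fst, z0.snd)
  have h4 : (WithLp.toLp 2 (z0.fst, z0.snd) - z0 : WithLp 2 (ℝ × Euc d)) = 0 := sub_self z0
  rw [h4, norm_zero] at h3
  exact h3.eventually (gt_mem_nhds hr)

lemma test_sub {d n : ℕ} {A : Euc d → Matrix (Fin d) (Fin d) ℝ}
    {σ : Euc d → Matrix (Fin d) (Fin n) ℝ}
    (hA : ∀ x, A x = σ x * (σ x).transpose) {H : Euc d → Euc d → ℝ}
    {T : ℝ} {U : Set (Euc d)} {v : ℝ × Euc d → ℝ} (h : IsViscSubsolution d A H T U v)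
    (z0 P : WithLp 2 (ℝ × Euc d))
    (L : WithLp 2 (ℝ × Euc d) →L[ℝ] WithLp 2 (ℝ × Euc d)) (ν : ℝ)
    (ht : z0.fst ∈ Ioo 0 T) (hx : z0.snd ∈ U) (r : ℝ) (hr : 0 < r)
    (hexp : ∀ h : WithLp 2 (ℝ × Euc d), ‖h‖ < r → (z0 + h).ofLp ∈ Ioo 0 T ×ˢ U →
      v (z0 + h).ofLp ≤ v z0.ofLp + ⟪P, h⟫ + (1 / 2) * ⟪L h, h⟫ + ν * ‖h‖ ^ 2) :
    P.fst - ∑ k, (⟪L (WithLp.toLp 2 (0, colv (σ z0.snd) k)), WithLp.toLp 2 (0, colv (σ z0.snd) k)⟫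
      + 2 * ν * ‖colv (σ z0.snd) k‖ ^ 2) + H z0.snd P.snd ≤ 0 := by
  obtain ⟨hC, h1, h2, h3⟩ := quad_calc z0 P L ν
  have h4 := h _ hC z0.fst ht z0.snd hx (by
    have h5 : ∀ᶠ z in 𝓝[Ioo 0 T ×ˢ U] (z0.fst, z0.snd), v z - (⟪P, WithLp.toLp 2 z - z0⟫
      + (1 / 2) * ⟪L (WithLp.toLp 2 z - z0), WithLp.toLp 2 z - z0⟫
      + ν * ‖WithLp.toLp 2 z - z0‖ ^ 2) ≤ v (z0.fst, z0.snd) -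
      (⟪P, WithLp.toLp 2 (z0.fst, z0.snd) - z0⟫
      + (1 / 2) * ⟪L (WithLp.toLp 2 (z0.fst, z0.snd) - z0), WithLp.toLp 2 (z0.fst, z0.snd) - z0⟫
      + ν * ‖WithLp.toLp 2 (z0.fst, z0.snd) - z0‖ ^ 2) := by
      filter_upwards [nhdsWithin_le_nhds (toLp_tendsto z0 r hr), self_mem_nhdsWithin] with z hz hz'
      have h6 := hexp _ hz (by rw [add_sub_cancel]; exact hz')
      rw [add_sub_cancel] at h6
      have h7 : (WithLp.toLp 2 (z0.fst, z0.snd) - z0 : WithLp 2 (ℝ × Euc d)) = 0 := sub_self z0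
      rw [h7]
      simp only [inner_zero_right, norm_zero, mul_zero, add_zero, ne_eq, OfNat.ofNat_ne_zero,
        not_false_eq_true, zero_pow, sub_zero]
      have h8 : v z0.ofLp = v (z0.fst, z0.snd) := rfl
      rw [h8] at h6
      linarith
    exact h5)
  rw [op_eq A σ hA _ _ hC, h1, h2] at h4
  simp only [h3] at h4
  exact h4

lemma test_sup {d n : ℕ} {A : Euc d → Matrix (Fin d) (Fin d) ℝ}
    {σ : Euc d → Matrix (Fin d) (Fin n) ℝ}
    (hA : ∀ x, A x = σ x * (σ x).transpose) {H : Euc d → Euc d → ℝ}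
    {T : ℝ} {U : Set (Euc d)} {v : ℝ × Euc d → ℝ} (h : IsViscSupersolution d A H T U v)
    (z0 P : WithLp 2 (ℝ × Euc d))
    (L : WithLp 2 (ℝ × Euc d) →L[ℝ] WithLp 2 (ℝ × Euc d)) (ν : ℝ)
    (ht : z0.fst ∈ Ioo 0 T) (hx : z0.snd ∈ U) (r : ℝ) (hr : 0 < r)
    (hexp : ∀ h : WithLp 2 (ℝ × Euc d), ‖h‖ < r → (z0 + h).ofLp ∈ Ioo 0 T ×ˢ U →
      v z0.ofLp + ⟪P, h⟫ - (1 / 2) * ⟪L h, h⟫ - ν * ‖h‖ ^ 2 ≤ v (z0 + h).ofLp) :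
    0 ≤ P.fst + ∑ k, (⟪L (WithLp.toLp 2 (0, colv (σ z0.snd) k)),
      WithLp.toLp 2 (0, colv (σ z0.snd) k)⟫
      + 2 * ν * ‖colv (σ z0.snd) k‖ ^ 2) + H z0.snd P.snd := by
  obtain ⟨hC, h1, h2, h3⟩ := quad_calc z0 P (-L) (-ν)
  have h4 := h _ hC z0.fst ht z0.snd hx (by
    have h5 : ∀ᶠ z in 𝓝[Ioo 0 T ×ˢ U] (z0.fst, z0.snd), v (z0.fst, z0.snd) -
      (⟪P, WithLp.toLp 2 (z0.fst, z0.snd) - z0⟫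
      + (1 / 2) * ⟪(-L) (WithLp.toLp 2 (z0.fst, z0.snd) - z0), WithLp.toLp 2 (z0.fst, z0.snd) - z0⟫
      + (-ν) * ‖WithLp.toLp 2 (z0.fst, z0.snd) - z0‖ ^ 2) ≤ v z - (⟪P, WithLp.toLp 2 z - z0⟫
      + (1 / 2) * ⟪(-L) (WithLp.toLp 2 z - z0), WithLp.toLp 2 z - z0⟫
      + (-ν) * ‖WithLp.toLp 2 z - z0‖ ^ 2) := by
      filter_upwards [nhdsWithin_le_nhds (toLp_tendsto z0 r hr), self_mem_nhdsWithin] with z hz hz'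
      have h6 := hexp _ hz (by rw [add_sub_cancel]; exact hz')
      rw [add_sub_cancel] at h6
      have h7 : (WithLp.toLp 2 (z0.fst, z0.snd) - z0 : WithLp 2 (ℝ × Euc d)) = 0 := sub_self z0
      rw [h7, neg_apply, neg_apply, inner_neg_left, inner_neg_left]
      simp only [inner_zero_right, norm_zero, mul_zero, add_zero, ne_eq, OfNat.ofNat_ne_zero,
        not_false_eq_true, zero_pow, sub_zero, neg_zero]
      have h8 : v z0.ofLp = v (z0.fst, z0.snd) := rfl
      rw [h8] at h6
      linarith
    exact h5)
  rw [op_eq A σ hA _ _ hC, h1, h2] at h4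
  simp only [h3] at h4
  simp only [neg_apply, inner_neg_left] at h4
  have e : ∑ k, (-⟪L (WithLp.toLp 2 (0, colv (σ z0.snd) k)),
      WithLp.toLp 2 (0, colv (σ z0.snd) k)⟫
      + 2 * -ν * ‖colv (σ z0.snd) k‖ ^ 2) = - ∑ k, (⟪L (WithLp.toLp 2 (0, colv (σ z0.snd) k)),
      WithLp.toLp 2 (0, colv (σ z0.snd) k)⟫
      + 2 * ν * ‖colv (σ z0.snd) k‖ ^ 2) := by
    rw [← Finset.sum_neg_distrib]
    refine Finset.sum_congr rfl fun k _ => ?_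
    ring
  rw [e, sub_neg_eq_add] at h4
  exact h4

end Visc2

section Visc3

open Topology

lemma core_ineq {d n : ℕ} {A : Euc d → Matrix (Fin d) (Fin d) ℝ}
    {σ : Euc d → Matrix (Fin d) (Fin n) ℝ} {ΛA : ℝ} (hΛA : 0 < ΛA)
    (hA : ∀ x, A x = σ x * (σ x).transpose)
    (hb : ∀ x, matFrobNorm (σ x) ≤ ΛA)
    (hl : ∀ x y, matFrobNorm (σ x - σ y) ≤ ΛA * ‖x - y‖)
    {H H' : Euc d → Euc d → ℝ}
    {T : ℝ} {U : Set (Euc d)} {v w : ℝ × Euc d → ℝ}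
    (hsub : IsViscSubsolution d A H' T U v) (hsup : IsViscSupersolution d A H T U w)
    (zs ws p1 p2 q : WithLp 2 (ℝ × Euc d))
    (L1 L2 : WithLp 2 (ℝ × Euc d) →L[ℝ] WithLp 2 (ℝ × Euc d)) (ε : ℝ) (hε : 0 < ε)
    (hz : zs.ofLp ∈ Ioo 0 T ×ˢ U) (hw : ws.ofLp ∈ Ioo 0 T ×ˢ U)
    (h1 : ∀ ν > 0, ∃ r > 0, ∀ h : WithLp 2 (ℝ × Euc d), ‖h‖ < r →
        (zs + h).ofLp ∈ Ioo 0 T ×ˢ U →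
        v (zs + h).ofLp ≤ v zs.ofLp + ⟪q + p1, h⟫ + (1 / 2) * ⟪L1 h, h⟫ + ν * ‖h‖ ^ 2)
    (h2 : ∀ ν > 0, ∃ r > 0, ∀ h : WithLp 2 (ℝ × Euc d), ‖h‖ < r →
        (ws + h).ofLp ∈ Ioo 0 T ×ˢ U →
        w ws.ofLp + ⟪q - p2, h⟫ - (1 / 2) * ⟪L2 h, h⟫ - ν * ‖h‖ ^ 2 ≤ w (ws + h).ofLp)
    (h12 : ∀ h k, ⟪L1 h, h⟫ + ⟪L2 k, k⟫ ≤ ‖h - k‖ ^ 2 / ε) (τ : ℝ) (hτ : 0 < τ) :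
    H' zs.snd (q + p1).snd ≤ ΛA ^ 2 * ‖zs.snd - ws.snd‖ ^ 2 / ε + ‖p1‖ + ‖p2‖
      + H ws.snd (q - p2).snd + τ := by
  have hν : 0 < τ / (4 * ΛA ^ 2) := by positivity
  obtain ⟨r1, hr1, e1⟩ := h1 _ hν
  obtain ⟨r2, hr2, e2⟩ := h2 _ hν
  have t1 := test_sub hA hsub zs (q + p1) L1 _ hz.1 hz.2 r1 hr1 e1
  have t2 := test_sup hA hsup ws (q - p2) L2 _ hw.1 hw.2 r2 hr2 e2
  set ν := τ / (4 * ΛA ^ 2) with hνd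
  rw [Finset.sum_add_distrib, ← Finset.mul_sum, sum_colv] at t1 t2
  have s : ∑ k, ⟪L1 (WithLp.toLp 2 (0, colv (σ zs.snd) k)),
        WithLp.toLp 2 (0, colv (σ zs.snd) k)⟫
      + ∑ k, ⟪L2 (WithLp.toLp 2 (0, colv (σ ws.snd) k)), WithLp.toLp 2 (0, colv (σ ws.snd) k)⟫
      ≤ ΛA ^ 2 * ‖zs.snd - ws.snd‖ ^ 2 / ε := by
    rw [← Finset.sum_add_distrib]
    calc _ ≤ ∑ k, ‖colv (σ zs.snd - σ ws.snd) k‖ ^ 2 / ε := by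
          refine Finset.sum_le_sum fun k _ => (h12 _ _).trans (le_of_eq ?_)
          rw [← WithLp.toLp_sub, WithLp.prod_norm_sq_eq_of_L2, colv_sub]
          simp
      _ = matFrobNorm (σ zs.snd - σ ws.snd) ^ 2 / ε := by
          rw [← Finset.sum_div, sum_colv]
      _ ≤ (ΛA * ‖zs.snd - ws.snd‖) ^ 2 / ε := by
          have : 0 ≤ matFrobNorm (σ zs.snd - σ ws.snd) := Real.sqrt_nonneg _
          gcongr
          exact hl _ _
      _ = _ := by rw [mul_pow]
  have b1 : 2 * ν * matFrobNorm (σ zs.snd) ^ 2 ≤ τ / 2 := by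
    have : 0 ≤ matFrobNorm (σ zs.snd) := Real.sqrt_nonneg _
    calc _ ≤ 2 * ν * ΛA ^ 2 := by gcongr; exact hb _
      _ = τ / 2 := by rw [hνd]; field_simp; norm_num
  have b2 : 2 * ν * matFrobNorm (σ ws.snd) ^ 2 ≤ τ / 2 := by
    have : 0 ≤ matFrobNorm (σ ws.snd) := Real.sqrt_nonneg _
    calc _ ≤ 2 * ν * ΛA ^ 2 := by gcongr; exact hb _
      _ = τ / 2 := by rw [hνd]; field_simp; norm_num
  have f1 : |p1.fst| ≤ ‖p1‖ := by
    have := WithLp.prod_norm_sq_eq_of_L2 p1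
    rw [← Real.norm_eq_abs]
    refine abs_le_of_sq_le_sq' ?_ (norm_nonneg _) |>.2
    nlinarith [sq_nonneg ‖p1.snd‖]
  have f2 : |p2.fst| ≤ ‖p2‖ := by
    have := WithLp.prod_norm_sq_eq_of_L2 p2
    rw [← Real.norm_eq_abs]
    refine abs_le_of_sq_le_sq' ?_ (norm_nonneg _) |>.2
    nlinarith [sq_nonneg ‖p2.snd‖]
  have g1 : (q + p1).fst = q.fst + p1.fst := rfl
  have g2 : (q - p2).fst = q.fst - p2.fst := rfl
  have := neg_abs_le p1.fst
  have := neg_abs_le p2.fst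
  rw [g1] at t1
  rw [g2] at t2
  linarith

lemma H_diff {d : ℕ} {m Λ : ℝ} {a M : ℝ → ℝ} {H : Euc d → Euc d → ℝ} (hH : MemH d m Λ a M H)
    (r : ℝ) (hr : 0 < r) (x y p q : Euc d) (hx : x ∈ ball (0 : Euc d) r)
    (hy : y ∈ ball (0 : Euc d) r) :
    H y q ≤ H x p + (Λ * ‖p‖ ^ m + M r) * ‖x - y‖
      + Λ * (‖q‖ + ‖p‖ + 1) ^ (m - 1) * ‖q - p‖ := by
  have h1 := (abs_le.1 (hH.1 y q p)).2
  have h2 := (abs_le.1 ((hH.2 r hr).2 x hx y hy p)).1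
  linarith

lemma usc_pull {d : ℕ} {D : Set (ℝ × Euc d)} {v : ℝ × Euc d → ℝ}
    (hv : UpperSemicontinuousOn v D) :
    UpperSemicontinuousOn (fun z : WithLp 2 (ℝ × Euc d) => v z.ofLp) (WithLp.ofLp ⁻¹' D) := by
  intro z hz y hy
  have h := hv z.ofLp hz y hy
  have hc : Continuous (WithLp.ofLp : WithLp 2 (ℝ × Euc d) → ℝ × Euc d) :=
    WithLp.prod_continuous_ofLp 2 ℝ (Euc d)
  have : Tendsto (WithLp.ofLp : WithLp 2 (ℝ × Euc d) → ℝ × Euc d) (𝓝[WithLp.ofLp ⁻¹' D] z)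
      (𝓝[D] z.ofLp) :=
    hc.continuousWithinAt.tendsto_nhdsWithin (fun _ h => h)
  exact this.eventually h

lemma lsc_pull {d : ℕ} {D : Set (ℝ × Euc d)} {v : ℝ × Euc d → ℝ}
    (hv : LowerSemicontinuousOn v D) :
    LowerSemicontinuousOn (fun z : WithLp 2 (ℝ × Euc d) => v z.ofLp) (WithLp.ofLp ⁻¹' D) := by
  intro z hz y hy
  have h := hv z.ofLp hz y hy
  have hc : Continuous (WithLp.ofLp : WithLp 2 (ℝ × Euc d) → ℝ × Euc d) :=
    WithLp.prod_continuous_ofLp 2 ℝ (Euc d)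
  have : Tendsto (WithLp.ofLp : WithLp 2 (ℝ × Euc d) → ℝ × Euc d) (𝓝[WithLp.ofLp ⁻¹' D] z)
      (𝓝[D] z.ofLp) :=
    hc.continuousWithinAt.tendsto_nhdsWithin (fun _ h => h)
  exact this.eventually h

end Visc3

section Visc4

open Topology

lemma doubling {F : Type*} [NormedAddCommGroup F] [InnerProductSpace ℝ F] [FiniteDimensional ℝ F]
    (D O : Set F) (hD : IsCompact D) (hO : IsOpen O)
    (v w : F → ℝ) (hv : UpperSemicontinuousOn v D) (hw : LowerSemicontinuousOn w D)
    (b : ℝ) (hbad : ∀ z ∈ D, z ∉ O → v z - w z ≤ b) (P1 : F) (hP1 : P1 ∈ D)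
    (hP : b < v P1 - w P1) (g η : ℝ) (hg : 0 < g) (hη : 0 < η) :
    ∃ (ε Q δ0 : ℝ), 0 < ε ∧ 0 ≤ Q ∧ 0 < δ0 ∧ ∀ δ, 0 < δ → δ ≤ δ0 →
    ∃ (q zs ws p1 p2 : F) (L1 L2 : F →L[ℝ] F), zs ∈ O ∧ ws ∈ O ∧ ‖p1‖ ≤ δ ∧ ‖p2‖ ≤ δ ∧
      ‖zs - ws‖ ≤ g ∧ ‖zs - ws‖ ^ 2 ≤ ε * η ∧ ‖q‖ ≤ Q ∧
      (∀ ν > 0, ∃ r > 0, ∀ h : F, ‖h‖ < r → zs + h ∈ D →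
        v (zs + h) ≤ v zs + ⟪q + p1, h⟫ + (1 / 2) * ⟪L1 h, h⟫ + ν * ‖h‖ ^ 2) ∧
      (∀ ν > 0, ∃ r > 0, ∀ h : F, ‖h‖ < r → ws + h ∈ D →
        w ws + ⟪q - p2, h⟫ - (1 / 2) * ⟪L2 h, h⟫ - ν * ‖h‖ ^ 2 ≤ w (ws + h)) ∧
      (∀ h k, ⟪L1 h, h⟫ + ⟪L2 k, k⟫ ≤ ‖h - k‖ ^ 2 / ε) := by
  have hne : D.Nonempty := ⟨P1, hP1⟩
  have hw' : UpperSemicontinuousOn (fun z => - w z) D := by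
    intro x hx y hy
    have := hw x hx (-y) (by linarith)
    filter_upwards [this] with z hz
    linarith
  have hvw : UpperSemicontinuousOn (fun z => v z + - w z) D := hv.add hw'
  obtain ⟨z0, hz0, hz0m⟩ := hvw.exists_isMaxOn hne hD
  obtain ⟨a0, ha0, ha0m⟩ := hv.exists_isMaxOn hne hD
  obtain ⟨b0, hb0, hb0m⟩ := hw.exists_isMinOn hne hD
  set S := v z0 - w z0 with hS
  have hSmax : ∀ z ∈ D, v z - w z ≤ S := fun z hz => by
    have : v z + - w z ≤ v z0 + - w z0 := hz0m hz
    linarith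
  have hC0 : ∀ x ∈ D, ∀ y ∈ D, v x - w y ≤ v a0 - w b0 := fun x hx y hy => by
    have h1 : v x ≤ v a0 := ha0m hx
    have h2 : w b0 ≤ w y := hb0m hy
    linarith
  have hSb : b < S := hP.trans_le (hSmax P1 hP1)
  set C' := v a0 - w b0 - S + 1 with hC'
  have hC'1 : 1 ≤ C' := by
    have := hC0 z0 hz0 z0 hz0
    linarith
  obtain ⟨ρ1, hρ1, hn1⟩ := near_bad D Oᶜ hD hO.isClosed_compl v w hv hw ((b + S) / 2)
    (fun z hz => by have := hbad z hz.1 hz.2; linarith)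
  obtain ⟨ρ2, hρ2, hn2⟩ := near_bad D univ hD isClosed_univ v w hv hw (S + η / 12)
    (fun z hz => by have := hSmax z hz.1; linarith)
  set g' := min g (min ρ1 ρ2) with hg'
  have hg'0 : 0 < g' := lt_min hg (lt_min hρ1 hρ2)
  have hε : 0 < g' ^ 2 / (6 * C') := by positivity
  set ε := g' ^ 2 / (6 * C') with hεd
  refine ⟨ε, √(2 * ε * C') / ε, min 1 (min (η / 12) ((S - b) / 2)), hε, by positivity,
    lt_min one_pos (lt_min (by positivity) (by linarith)), fun δ hδ hδ0 => ?_⟩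
  have hδ1 : δ ≤ 1 := hδ0.trans (min_le_left _ _)
  have hδ2 : δ ≤ η / 12 := hδ0.trans ((min_le_right _ _).trans (min_le_left _ _))
  have hδ3 : δ ≤ (S - b) / 2 := hδ0.trans ((min_le_right _ _).trans (min_le_right _ _))
  obtain ⟨ζ, ω, zs, ws, p1, p2, L1, L2, hzs, hws, hp1, hp2, hmax, e1, e2, e12⟩ :=
    sums_thm D hD hne v w hv hw ε δ hε hδ
  set Nn := ‖ζ - zs‖ ^ 2 + ‖ω - ws‖ ^ 2 + ‖ζ - ω‖ ^ 2 with hNn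
  have hN0 : 0 ≤ Nn / (2 * ε) := by positivity
  have hm0 := hmax z0 hz0
  rw [← hS] at hm0
  have hc0 := hC0 zs hzs ws hws
  have hN1 : Nn ≤ 2 * ε * C' := by
    have : Nn / (2 * ε) ≤ C' := by linarith
    rw [div_le_iff₀ (by positivity)] at this
    linarith
  have hd3 : ‖zs - ws‖ ^ 2 ≤ 3 * Nn := by
    have h1 : ‖zs - ws‖ ≤ ‖ζ - zs‖ + ‖ω - ws‖ + ‖ζ - ω‖ := by
      have : zs - ws = -(ζ - zs) + (ω - ws) + (ζ - ω) := by abel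
      rw [this]
      refine (norm_add_le _ _).trans ?_
      gcongr
      refine (norm_add_le _ _).trans ?_
      rw [norm_neg]
    have h2 : ‖zs - ws‖ ^ 2 ≤ (‖ζ - zs‖ + ‖ω - ws‖ + ‖ζ - ω‖) ^ 2 := by gcongr
    nlinarith [sq_nonneg (‖ζ - zs‖ - ‖ω - ws‖), sq_nonneg (‖ζ - zs‖ - ‖ζ - ω‖),
      sq_nonneg (‖ω - ws‖ - ‖ζ - ω‖)]
  have hgg : 6 * ε * C' = g' ^ 2 := by rw [hεd]; field_simp
  have hdg : ‖zs - ws‖ ≤ g' := by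
    refine (abs_le_of_sq_le_sq' ?_ hg'0.le).2
    linarith
  have hdist : dist zs ws ≤ g' := by rwa [dist_eq_norm]
  have hlow : (b + S) / 2 ≤ v zs - w ws := by linarith
  have hO1 : zs ∈ O ∧ ws ∈ O := by
    by_contra hcon
    have h1 := hn1 zs hzs ws hws (hdist.trans ((min_le_right _ _).trans (min_le_left _ _))) (by
      by_contra h2
      push Not at h2
      exact hcon ⟨not_not.1 h2.1, not_not.1 h2.2⟩)
    linarith
  have h2 := hn2 zs hzs ws hws (hdist.trans ((min_le_right _ _).trans (min_le_right _ _)))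
    (Or.inl (mem_univ _))
  have hN2 : Nn ≤ ε * (η / 3) := by
    have : Nn / (2 * ε) ≤ η / 6 := by linarith
    rw [div_le_iff₀ (by positivity)] at this
    linarith
  refine ⟨(1 / ε) • (ζ - ω), zs, ws, p1, p2, L1, L2, hO1.1, hO1.2, hp1, hp2,
    hdg.trans (min_le_left _ _), by linarith, ?_, e1, e2, e12⟩
  rw [norm_smul, Real.norm_of_nonneg (by positivity), one_div, inv_mul_eq_div]
  gcongr
  apply Real.le_sqrt_of_sq_le
  have : ‖ζ - ω‖ ^ 2 ≤ Nn := by rw [hNn]; nlinarith [sq_nonneg ‖ζ - zs‖, sq_nonneg ‖ω - ws‖]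
  linarith

end Visc4

section Visc5

open Topology

lemma snd_norm_le {d : ℕ} (z : WithLp 2 (ℝ × Euc d)) : ‖z.snd‖ ≤ ‖z‖ := by
  have := WithLp.prod_norm_sq_eq_of_L2 z
  refine abs_le_of_sq_le_sq' ?_ (norm_nonneg _) |>.2
  nlinarith [sq_nonneg ‖z.fst‖]

lemma local_comp {d : ℕ} {A : Euc d → Matrix (Fin d) (Fin d) ℝ} {ΛA : ℝ} (hΛA : 0 < ΛA)
    (hA : CondA d ΛA A) {m Λ : ℝ} (hm : 1 < m) (hΛ : 0 < Λ) {a M : ℝ → ℝ}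
    (haM : GoodFamilies a M) {H : Euc d → Euc d → ℝ} (hH : MemH d m Λ a M H)
    {r : ℝ} (hr : 0 < r) {Kc U : Set (Euc d)} (hKc : IsCompact Kc) (hKr : Kc ⊆ ball 0 r)
    (hU : IsOpen U) (hUK : U ⊆ Kc) {T : ℝ} {v w : ℝ × Euc d → ℝ}
    (hv : UpperSemicontinuousOn v (Icc 0 T ×ˢ Kc)) (hw : LowerSemicontinuousOn w (Icc 0 T ×ˢ Kc))
    {κ γ : ℝ} (hκ : 0 < κ) (hγ : 0 < γ)
    (hsub : IsViscSubsolution d A (fun x p => H x p + κ * ‖p‖ ^ m + γ) T U v)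
    (hsup : IsViscSupersolution d A H T U w)
    {b : ℝ} (hbad : ∀ z ∈ Icc 0 T ×ˢ Kc, z ∉ Ioo 0 T ×ˢ U → v z - w z ≤ b)
    {P1 : ℝ × Euc d} (hP1 : P1 ∈ Icc 0 T ×ˢ Kc) (hP : b < v P1 - w P1) : False := by
  obtain ⟨n, σ, hA1, hA2, hA3⟩ := hA
  have hM : 1 ≤ M r := (haM r hr).2
  have hco : Continuous (WithLp.ofLp : WithLp 2 (ℝ × Euc d) → ℝ × Euc d) :=
    WithLp.prod_continuous_ofLp 2 ℝ (Euc d)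
  have hct : Continuous (WithLp.toLp 2 : ℝ × Euc d → WithLp 2 (ℝ × Euc d)) :=
    WithLp.prod_continuous_toLp 2 ℝ (Euc d)
  have hD : IsCompact (WithLp.ofLp ⁻¹' (Icc 0 T ×ˢ Kc) : Set (WithLp 2 (ℝ × Euc d))) := by
    have h1 := ((isCompact_Icc (a := (0:ℝ)) (b := T)).prod hKc).image hct
    have h2 : (WithLp.ofLp ⁻¹' (Icc 0 T ×ˢ Kc) : Set (WithLp 2 (ℝ × Euc d)))
        = WithLp.toLp 2 '' (Icc 0 T ×ˢ Kc) := by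
      ext z
      constructor
      · intro hz
        exact ⟨z.ofLp, hz, rfl⟩
      · rintro ⟨y, hy, rfl⟩
        exact hy
    rw [h2]; exact h1
  have hO : IsOpen (WithLp.ofLp ⁻¹' (Ioo 0 T ×ˢ U) : Set (WithLp 2 (ℝ × Euc d))) :=
    (isOpen_Ioo.prod hU).preimage hco
  have hOD : Ioo 0 T ×ˢ U ⊆ Icc 0 T ×ˢ Kc := prod_mono Ioo_subset_Icc_self hUK
  have hg : 0 < min (κ / Λ) (γ / (8 * M r)) := lt_min (by positivity) (by positivity)
  have hη : 0 < γ / (8 * ΛA ^ 2) := by positivity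
  obtain ⟨ε, Q, δ0, hε, hQ, hδ0, hmain⟩ := doubling _ _ hD hO _ _ (usc_pull hv) (lsc_pull hw) b
    (fun z hz hz' => hbad z.ofLp hz hz') (WithLp.toLp 2 P1) hP1 hP _ _ hg hη
  have hB : 0 < Λ * (2 * Q + 3) ^ (m - 1) := by positivity
  set B := Λ * (2 * Q + 3) ^ (m - 1) with hBd
  have hδ : 0 < min δ0 (min 1 (min (γ / 16) (γ / (16 * B)))) :=
    lt_min hδ0 (lt_min one_pos (lt_min (by positivity) (by positivity)))
  obtain ⟨q, zs, ws, p1, p2, L1, L2, hzs, hws, hp1, hp2, hd1, hd2, hq, e1, e2, e12⟩ :=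
    hmain _ hδ (min_le_left _ _)
  set δ := min δ0 (min 1 (min (γ / 16) (γ / (16 * B)))) with hδd
  have hδ1 : δ ≤ 1 := (min_le_right _ _).trans (min_le_left _ _)
  have hδ2 : δ ≤ γ / 16 := (min_le_right _ _).trans ((min_le_right _ _).trans (min_le_left _ _))
  have hδ3 : δ ≤ γ / (16 * B) :=
    (min_le_right _ _).trans ((min_le_right _ _).trans (min_le_right _ _))
  have key := core_ineq hΛA hA1 hA2 hA3 hsub hsup zs ws p1 p2 q L1 L2 ε hε hzs hws
    (fun ν hν => by
      obtain ⟨r, hr, h⟩ := e1 ν hν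
      exact ⟨r, hr, fun k hk hk' => h k hk (hOD hk')⟩)
    (fun ν hν => by
      obtain ⟨r, hr, h⟩ := e2 ν hν
      exact ⟨r, hr, fun k hk hk' => h k hk (hOD hk')⟩) e12 (γ / 8) (by positivity)
  have hHd := H_diff hH r hr zs.snd ws.snd (q + p1).snd (q - p2).snd (hKr (hUK hzs.2))
    (hKr (hUK hws.2))
  have hx : ‖zs.snd - ws.snd‖ ≤ ‖zs - ws‖ := snd_norm_le (zs - ws)
  have k1 : ΛA ^ 2 * ‖zs.snd - ws.snd‖ ^ 2 / ε ≤ γ / 8 := by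
    have : ‖zs.snd - ws.snd‖ ^ 2 ≤ ε * (γ / (8 * ΛA ^ 2)) := by
      refine le_trans ?_ hd2
      gcongr
    rw [div_le_iff₀ hε]
    calc _ ≤ ΛA ^ 2 * (ε * (γ / (8 * ΛA ^ 2))) := by gcongr
      _ = γ / 8 * ε := by field_simp
  have hdx := hx.trans hd1
  have k2 : (Λ * ‖(q + p1).snd‖ ^ m + M r) * ‖zs.snd - ws.snd‖ ≤ κ * ‖(q + p1).snd‖ ^ m + γ / 8 := by
    have h1 : ‖zs.snd - ws.snd‖ ≤ κ / Λ := hdx.trans (min_le_left _ _)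
    have h2 : ‖zs.snd - ws.snd‖ ≤ γ / (8 * M r) := hdx.trans (min_le_right _ _)
    rw [le_div_iff₀ hΛ] at h1
    rw [le_div_iff₀ (by positivity)] at h2
    have h3 : 0 ≤ ‖(q + p1).snd‖ ^ m := by positivity
    nlinarith [mul_le_mul_of_nonneg_left h1 h3]
  have k3 : Λ * (‖(q - p2).snd‖ + ‖(q + p1).snd‖ + 1) ^ (m - 1) * ‖(q - p2).snd - (q + p1).snd‖
      ≤ γ / 8 := by
    have h1 : ‖(q - p2).snd‖ ≤ Q + 1 :=
      (snd_norm_le _).trans ((norm_sub_le _ _).trans (by linarith))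
    have h2 : ‖(q + p1).snd‖ ≤ Q + 1 :=
      (snd_norm_le _).trans ((norm_add_le _ _).trans (by linarith))
    have h3 : ‖(q - p2).snd - (q + p1).snd‖ ≤ 2 * δ := by
      have e : (q - p2).snd - (q + p1).snd = (-p2 - p1).snd := by
        have : (q - p2) - (q + p1) = -p2 - p1 := by abel
        rw [← this]; rfl
      rw [e]
      refine (snd_norm_le _).trans ((norm_sub_le _ _).trans ?_)
      rw [norm_neg]; linarith
    have h4 : Λ * (‖(q - p2).snd‖ + ‖(q + p1).snd‖ + 1) ^ (m - 1) ≤ B := by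
      rw [hBd]
      exact mul_le_mul_of_nonneg_left
        (Real.rpow_le_rpow (by positivity) (by linarith) (by linarith)) hΛ.le
    calc _ ≤ B * (2 * δ) := by gcongr
      _ ≤ B * (2 * (γ / (16 * B))) := by gcongr
      _ = γ / 8 := by field_simp; norm_num
  linarith

end Visc5

section Visc6

open Topology

lemma usc_mul {X : Type*} [TopologicalSpace X] {D : Set X} {v : X → ℝ}
    (hv : UpperSemicontinuousOn v D) (μ : ℝ) (hμ : 0 < μ) :
    UpperSemicontinuousOn (fun z => μ * v z) D := by
  intro x hx y hy
  have h1 : v x < y / μ := by rw [lt_div_iff₀ hμ]; linarith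
  filter_upwards [hv x hx _ h1] with z hz
  rw [lt_div_iff₀ hμ] at hz
  linarith

lemma local_comp2 {d : ℕ} {A : Euc d → Matrix (Fin d) (Fin d) ℝ} {ΛA : ℝ} (hΛA : 0 < ΛA)
    (hA : CondA d ΛA A) {m Λ : ℝ} (hm : 1 < m) (hΛ : 0 < Λ) {a M : ℝ → ℝ}
    (haM : GoodFamilies a M) {H : Euc d → Euc d → ℝ} (hH : MemH d m Λ a M H)
    {r : ℝ} (hr : 0 < r) {Kc U : Set (Euc d)} (hKc : IsCompact Kc) (hKr : Kc ⊆ ball 0 r)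
    (hU : IsOpen U) (hUK : U ⊆ Kc) {T : ℝ} {v w : ℝ × Euc d → ℝ}
    (hv : UpperSemicontinuousOn v (Icc 0 T ×ˢ Kc)) (hw : LowerSemicontinuousOn w (Icc 0 T ×ˢ Kc))
    {κ C γ : ℝ} (hκ : 0 < κ) (hC : 0 ≤ C) (hγ : 0 < γ)
    (hstr : ∀ x ∈ ball (0 : Euc d) r, ∀ (p : Euc d) (μ : ℝ), 1 / 2 ≤ μ → μ ≤ 1 →
      H x (μ • p) ≤ μ * H x p - (1 - μ) * (κ * ‖p‖ ^ m - C))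
    (hsub : IsViscSubsolution d A (fun x p => H x p + γ) T U v)
    (hsup : IsViscSupersolution d A H T U w)
    {b : ℝ} (hbad : ∀ z ∈ Icc 0 T ×ˢ Kc, z ∉ Ioo 0 T ×ˢ U → v z - w z ≤ b)
    {P1 : ℝ × Euc d} (hP1 : P1 ∈ Icc 0 T ×ˢ Kc) (hP : b < v P1 - w P1) : False := by
  have hD : IsCompact (Icc 0 T ×ˢ Kc) := (isCompact_Icc (a := (0:ℝ)) (b := T)).prod hKc
  obtain ⟨b0, hb0, hb0m⟩ := hw.exists_isMinOn ⟨P1, hP1⟩ hD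
  have hwm : ∀ z ∈ Icc 0 T ×ˢ Kc, w b0 ≤ w z := fun z hz => hb0m hz
  set X := |w P1 - w b0| + 1 with hX
  have hX0 : 0 < X := by positivity
  set s := v P1 - w P1 - b with hs
  have hs0 : 0 < s := by linarith
  have hθ : 0 < min (1 / 2) (min (s / (4 * X)) (γ / (4 * (C + 1)))) :=
    lt_min (by norm_num) (lt_min (by positivity) (by positivity))
  set θ := min (1 / 2) (min (s / (4 * X)) (γ / (4 * (C + 1)))) with hθd
  have h1 : θ ≤ 1 / 2 := min_le_left _ _
  have h2 : θ ≤ s / (4 * X) := (min_le_right _ _).trans (min_le_left _ _)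
  have h3 : θ ≤ γ / (4 * (C + 1)) := (min_le_right _ _).trans (min_le_right _ _)
  rw [le_div_iff₀ (by positivity)] at h2 h3
  have hXle : w P1 - w b0 ≤ X := by
    have := le_abs_self (w P1 - w b0)
    linarith
  refine local_comp hΛA hA hm hΛ haM hH hr hKc hKr hU hUK (usc_mul hv (1 - θ) (by linarith)) hw
    (κ := (1 - (1 - θ)) * κ) (γ := γ / 4) (by rw [sub_sub_cancel]; positivity) (by positivity)
    (stage2 hA m κ C r (by linarith) hκ.le hstr (hUK.trans hKr) γ hsub (1 - θ) (γ / 4)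
      (by linarith) (by linarith) ?_) hsup (b := (1 - θ) * b - θ * w b0) ?_ hP1 ?_
  · nlinarith
  · intro z hz hz'
    have e1 := hbad z hz hz'
    have e2 := hwm z hz
    nlinarith
  · have : θ * (w P1 - w b0) ≤ θ * X := mul_le_mul_of_nonneg_left hXle hθ.le
    have : (1 / 2) * s ≤ (1 - θ) * s := mul_le_mul_of_nonneg_right (by linarith) hs0.le
    rw [hs] at *
    nlinarith

end Visc6

section Visc7

open Topology

lemma growth_above {d : ℕ} {T : ℝ} {U : Set (Euc d)} {v : ℝ × Euc d → ℝ}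
    (hv : UpperSemicontinuousOn v (Icc 0 T ×ˢ closure U)) (hg : SublinearAbove d T U v)
    (ε : ℝ) (hε : 0 < ε) :
    ∃ C, 0 ≤ C ∧ ∀ t ∈ Icc (0:ℝ) T, ∀ x ∈ U, v (t, x) ≤ ε * (1 + ‖x‖) + C := by
  obtain ⟨R, hR⟩ := hg ε hε
  have hK : IsCompact (Icc 0 T ×ˢ (closure U ∩ closedBall 0 R)) :=
    (isCompact_Icc (a := (0:ℝ)) (b := T)).prod
      ((isCompact_closedBall (0 : Euc d) R).inter_left isClosed_closure)
  have hv' := hv.mono (prod_mono_right (s := Icc 0 T) (inter_subset_left (s := closure U)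
    (t := closedBall 0 R)))
  obtain ⟨B, hB⟩ : ∃ B, ∀ z ∈ Icc 0 T ×ˢ (closure U ∩ closedBall 0 R), v z ≤ B := by
    rcases (Icc 0 T ×ˢ (closure U ∩ closedBall 0 R)).eq_empty_or_nonempty with h | h
    · refine ⟨0, fun z hz => ?_⟩
      rw [h] at hz
      exact hz.elim
    · obtain ⟨z0, _, hz0⟩ := hv'.exists_isMaxOn h hK
      exact ⟨v z0, fun z hz => hz0 hz⟩
  refine ⟨max B 0, le_max_right _ _, fun t ht x hx => ?_⟩
  have h0 : 0 ≤ ε * (1 + ‖x‖) := by positivity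
  rcases le_total R ‖x‖ with h | h
  · have := hR x hx h t ht
    linarith [le_max_right B 0]
  · have := hB (t, x) ⟨ht, subset_closure hx, by simpa using h⟩
    linarith [le_max_left B 0]

lemma growth_below {d : ℕ} {T : ℝ} {U : Set (Euc d)} {w : ℝ × Euc d → ℝ}
    (hw : LowerSemicontinuousOn w (Icc 0 T ×ˢ closure U)) (hg : SublinearBelow d T U w)
    (ε : ℝ) (hε : 0 < ε) :
    ∃ C, 0 ≤ C ∧ ∀ t ∈ Icc (0:ℝ) T, ∀ x ∈ U, -(ε * (1 + ‖x‖) + C) ≤ w (t, x) := by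
  have hv : UpperSemicontinuousOn (fun z => - w z) (Icc 0 T ×ˢ closure U) := by
    intro x hx y hy
    filter_upwards [hw x hx (-y) (by linarith)] with z hz
    linarith
  have hg' : SublinearAbove d T U (fun z => - w z) := by
    intro ε hε
    obtain ⟨R, hR⟩ := hg ε hε
    exact ⟨R, fun x hx h t ht => by have := hR x hx h t ht; linarith⟩
  obtain ⟨C, hC, h⟩ := growth_above hv hg' ε hε
  exact ⟨C, hC, fun t ht x hx => by have := h t ht x hx; linarith⟩

lemma growth_both {d : ℕ} {T : ℝ} {U : Set (Euc d)} {v w : ℝ × Euc d → ℝ}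
    (hv : UpperSemicontinuousOn v (Icc 0 T ×ˢ closure U)) (hgv : SublinearAbove d T U v)
    (hw : LowerSemicontinuousOn w (Icc 0 T ×ˢ closure U)) (hgw : SublinearBelow d T U w)
    (ε : ℝ) (hε : 0 < ε) :
    ∃ C, 0 ≤ C ∧ ∀ t ∈ Icc (0:ℝ) T, ∀ x ∈ U, v (t, x) ≤ ε * (1 + ‖x‖) + C ∧
      -(ε * (1 + ‖x‖) + C) ≤ w (t, x) := by
  obtain ⟨C1, hC1, h1⟩ := growth_above hv hgv ε hε
  obtain ⟨C2, hC2, h2⟩ := growth_below hw hgw ε hε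
  refine ⟨C1 + C2, by positivity, fun t ht x hx => ?_⟩
  have := h1 t ht x hx
  have := h2 t ht x hx
  constructor <;> linarith

lemma usc_min {X : Type*} [TopologicalSpace X] {D : Set X} {v g : X → ℝ}
    (hv : UpperSemicontinuousOn v D) (hg : Continuous g) :
    UpperSemicontinuousOn (fun z => min (v z) (g z)) D := by
  intro x hx y hy
  rcases min_lt_iff.1 hy with h | h
  · filter_upwards [hv x hx y h] with z hz
    exact min_lt_iff.2 (Or.inl hz)
  · have : ∀ᶠ z in 𝓝[D] x, g z < y :=
      nhdsWithin_le_nhds ((hg.tendsto x).eventually (gt_mem_nhds h))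
    filter_upwards [this] with z hz
    exact min_lt_iff.2 (Or.inr hz)

lemma lsc_max {X : Type*} [TopologicalSpace X] {D : Set X} {v g : X → ℝ}
    (hv : LowerSemicontinuousOn v D) (hg : Continuous g) :
    LowerSemicontinuousOn (fun z => max (v z) (- g z)) D := by
  intro x hx y hy
  rcases lt_max_iff.1 hy with h | h
  · filter_upwards [hv x hx y h] with z hz
    exact lt_max_iff.2 (Or.inl hz)
  · have : ∀ᶠ z in 𝓝[D] x, y < - g z :=
      nhdsWithin_le_nhds ((hg.neg.tendsto x).eventually (lt_mem_nhds h))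
    filter_upwards [this] with z hz
    exact lt_max_iff.2 (Or.inr hz)

lemma choose_l (X Y β : ℝ) (hβ : 0 < β) : ∃ l : ℝ, 1 / 2 ≤ l ∧ l < 1 ∧ (1 - l) * X ≤ β ∧
    (1 - l) * Y ≤ β := by
  have h0 : 0 < min (1 / 2) (β / (|X| + |Y| + 1)) := lt_min (by norm_num) (by positivity)
  set θ := min (1 / 2) (β / (|X| + |Y| + 1)) with hθ
  have h1 : θ ≤ 1 / 2 := min_le_left _ _
  have h2 : θ ≤ β / (|X| + |Y| + 1) := min_le_right _ _
  rw [le_div_iff₀ (by positivity)] at h2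
  refine ⟨1 - θ, by linarith, by linarith, ?_, ?_⟩
  · rw [sub_sub_cancel]
    have : X ≤ |X| + |Y| + 1 := by linarith [le_abs_self X, abs_nonneg Y]
    exact (mul_le_mul_of_nonneg_left this h0.le).trans h2
  · rw [sub_sub_cancel]
    have : Y ≤ |X| + |Y| + 1 := by linarith [le_abs_self Y, abs_nonneg X]
    exact (mul_le_mul_of_nonneg_left this h0.le).trans h2

lemma choose_N (E β τ : ℝ) (hβ : 0 < β) (hτ : 0 < τ) (hE : 0 ≤ E) :
    ∃ N : ℝ, 0 ≤ N ∧ Real.exp (N * (-τ)) ≤ β ∧ E ≤ Real.exp (N * τ) := by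
  refine ⟨(E + |Real.log β|) / τ, by positivity, ?_, ?_⟩
  · have : (E + |Real.log β|) / τ * (-τ) = -(E + |Real.log β|) := by field_simp
    rw [this, ← Real.le_log_iff_exp_le hβ]
    linarith [neg_abs_le (Real.log β)]
  · rw [div_mul_cancel₀ _ hτ.ne']
    have := Real.add_one_le_exp (E + |Real.log β|)
    linarith [abs_nonneg (Real.log β)]

end Visc7

/-- **Comparison principle when the infimum representation holds only for large momenta**
(Proposition `prop trivial`): if `H ∈ ℋ(m,Λ,(a_r),(M_r))` agrees with `inf_i H_i` for
`|p| ≥ ρ`, with `H_i ∈ 𝔅(m_i,Λ,(a_r),(M_r))`, then the comparison principle of Theorem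
`teo parabolic comp` still holds. -/
theorem statement15 (d : ℕ) (hd : 0 < d) (T : ℝ) (hT : 0 < T)
    (ΛA : ℝ) (hΛA : 0 < ΛA) (A : Euc d → Matrix (Fin d) (Fin d) ℝ) (hA : CondA d ΛA A)
    (m Λ : ℝ) (hm : 1 < m) (hΛ : 0 < Λ)
    (a M : ℝ → ℝ) (haM : GoodFamilies a M)
    (H : Euc d → Euc d → ℝ) (hH : MemH d m Λ a M H)
    (ρ : ℝ) (hρ : 0 < ρ)
    (I : Type) (hI : Nonempty I) (mi : I → ℝ) (hmi : ∀ i, 1 < mi i)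
    (Hi : I → Euc d → Euc d → ℝ) (hHi : ∀ i, MemB d (mi i) Λ a M (Hi i))
    (hinf : ∀ x p : Euc d, ρ ≤ ‖p‖ → H x p = ⨅ i, Hi i x p)
    (U : Set (Euc d)) (hU : IsOpen U)
    (v w : ℝ × Euc d → ℝ)
    (hv : UpperSemicontinuousOn v (Icc 0 T ×ˢ closure U))
    (hw : LowerSemicontinuousOn w (Icc 0 T ×ˢ closure U))
    (hsub : IsViscSubsolution d A H T U v)
    (hsup : IsViscSupersolution d A H T U w)
    (hgv : SublinearAbove d T U v) (hgw : SublinearBelow d T U w)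
    (c : ℝ) (hc : ∀ p ∈ parabolicBoundary d T U, v p - w p ≤ c) :
    ∀ t ∈ Ioo (0 : ℝ) T, ∀ x ∈ U, v (t, x) - w (t, x) ≤ c := by
  intro t1 ht1 x1 hx1
  by_contra hcon
  push Not at hcon
  obtain ⟨β, hβ0, hβ⟩ : ∃ β > 0, v (t1, x1) - w (t1, x1) = c + 4 * β :=
    ⟨(v (t1, x1) - w (t1, x1) - c) / 4, by linarith, by ring⟩
  obtain ⟨K, hK0, hK⟩ := H_quasi hm hΛ haM hH hρ hI hmi hHi hinf
  have hK1 : 0 ≤ K + ΛA ^ 2 + 1 := by positivity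
  obtain ⟨C0, hC0, hb0⟩ := growth_both hv hgv hw hgw (1 / 2) (by norm_num)
  obtain ⟨l, hl0, hl1, hlX, hlY⟩ := choose_l
    (v (t1, x1) + (Real.sqrt (1 + ‖x1‖ ^ 2) + (K + ΛA ^ 2 + 1) * t1)) (C0 - c) β hβ0
  have hθ : 0 < 1 - l := by linarith
  obtain ⟨C1, hC1, hb1⟩ := growth_both hv hgv hw hgw ((1 - l) / 4) (by linarith)
  -- the cap
  obtain ⟨g, hgdef⟩ : ∃ g : ℝ × Euc d → ℝ, g = fun z => min (1 / 2 * (1 + ‖z.2‖) + C0)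
    ((1 - l) / 4 * (1 + ‖z.2‖) + C1) := ⟨_, rfl⟩
  have hgc : Continuous g := by rw [hgdef]; fun_prop
  have hg0 : ∀ z, g z ≤ 1 / 2 * (1 + ‖z.2‖) + C0 := fun z => by
    rw [hgdef]; exact min_le_left _ _
  have hg1 : ∀ z, g z ≤ (1 - l) / 4 * (1 + ‖z.2‖) + C1 := fun z => by
    rw [hgdef]; exact min_le_right _ _
  have hgp : ∀ z, 0 ≤ g z := fun z => by
    rw [hgdef]; exact le_min (by positivity) (by positivity)
  obtain ⟨v', hv'def⟩ : ∃ v' : ℝ × Euc d → ℝ, v' = fun z => min (v z) (g z) := ⟨_, rfl⟩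
  obtain ⟨w', hw'def⟩ : ∃ w' : ℝ × Euc d → ℝ, w' = fun z => max (w z) (- g z) := ⟨_, rfl⟩
  have hv'v : ∀ z, v' z ≤ v z := fun z => by rw [hv'def]; exact min_le_left _ _
  have hv'g : ∀ z, v' z ≤ g z := fun z => by rw [hv'def]; exact min_le_right _ _
  have hw'w : ∀ z, w z ≤ w' z := fun z => by rw [hw'def]; exact le_max_left _ _
  have hw'g : ∀ z, - g z ≤ w' z := fun z => by rw [hw'def]; exact le_max_right _ _
  have hv'e : ∀ t ∈ Icc (0:ℝ) T, ∀ x ∈ U, v' (t, x) = v (t, x) := fun t ht x hx => by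
    rw [hv'def, hgdef]
    exact min_eq_left (le_min (hb0 t ht x hx).1 (hb1 t ht x hx).1)
  have hw'e : ∀ t ∈ Icc (0:ℝ) T, ∀ x ∈ U, w' (t, x) = w (t, x) := fun t ht x hx => by
    rw [hw'def, hgdef]
    refine max_eq_left (neg_le.2 (le_min ?_ ?_))
    · have := (hb0 t ht x hx).2
      linarith
    · have := (hb1 t ht x hx).2
      linarith
  -- times and radius
  obtain ⟨T', hT1, hT2⟩ := exists_between ht1.2
  have hT'0 : 0 < T' := ht1.1.trans hT1
  obtain ⟨E, hE⟩ : ∃ E, E = (1 - l) / 2 + 2 * C1 + |c| := ⟨_, rfl⟩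
  have hE0 : 0 ≤ E := by rw [hE]; positivity
  have hEc : (1 - l) / 2 + 2 * C1 - E ≤ c := by rw [hE]; linarith [neg_abs_le c]
  obtain ⟨N, hN0, hN1, hN2⟩ := choose_N E β ((T' - t1) / 2) hβ0 (by linarith) hE0
  obtain ⟨R, hR⟩ : ∃ R, R = 2 * E / (1 - l) + ‖x1‖ + 1 := ⟨_, rfl⟩
  have hR0 : 0 < R := by rw [hR]; positivity
  have hR1 : ‖x1‖ < R := by
    have : 0 ≤ 2 * E / (1 - l) := by positivity
    linarith
  have hR2 : E ≤ (1 - l) / 2 * R := by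
    have h1 : 2 * E / (1 - l) ≤ R := by linarith [norm_nonneg x1]
    rw [div_le_iff₀ hθ] at h1
    linarith
  obtain ⟨t2, ht2⟩ : ∃ t2, t2 = (t1 + T') / 2 := ⟨_, rfl⟩
  obtain ⟨V, hVdef⟩ : ∃ V : ℝ × Euc d → ℝ,
    V = fun z => l * v' z - psi d (1 - l) (K + ΛA ^ 2 + 1) N t2 z := ⟨_, rfl⟩
  have hVz : ∀ (t : ℝ) (x : Euc d), V (t, x) = l * v' (t, x) - ((1 - l) *
      (Real.sqrt (1 + ‖x‖ ^ 2) + (K + ΛA ^ 2 + 1) * t) + Real.exp (N * (t - t2))) :=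
    fun t x => by rw [hVdef]; rfl
  -- domains
  have hKc : IsCompact (closure U ∩ closedBall (0 : Euc d) R) :=
    (isCompact_closedBall (0 : Euc d) R).inter_left isClosed_closure
  have hKr : closure U ∩ closedBall (0 : Euc d) R ⊆ ball 0 (R + 1) :=
    inter_subset_right.trans (closedBall_subset_ball (by linarith))
  have hU' : IsOpen (U ∩ ball (0 : Euc d) R) := hU.inter isOpen_ball
  have hUK : U ∩ ball (0 : Euc d) R ⊆ closure U ∩ closedBall (0 : Euc d) R :=
    inter_subset_inter subset_closure ball_subset_closedBall
  have hDD : Icc 0 T' ×ˢ (closure U ∩ closedBall (0 : Euc d) R) ⊆ Icc 0 T ×ˢ closure U :=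
    prod_mono (Icc_subset_Icc_right hT2.le) inter_subset_left
  have hsub' : IsViscSubsolution d A H T' (U ∩ ball 0 R) v' :=
    sub_restrict hT2.le hU' inter_subset_left
      (fun z hz => hv'e z.1 ⟨hz.1.1.le, (hz.1.2.trans hT2).le⟩ z.2 hz.2.1) hsub
  have hsup' : IsViscSupersolution d A H T' (U ∩ ball 0 R) w' :=
    sup_restrict hT2.le hU' inter_subset_left
      (fun z hz => hw'e z.1 ⟨hz.1.1.le, (hz.1.2.trans hT2).le⟩ z.2 hz.2.1) hsup
  have hsubV := stage1 hΛA hA K hK hsub' l N t2 hl0 hl1.le hN0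
  rw [← hVdef] at hsubV
  have hpsic : Continuous (psi d (1 - l) (K + ΛA ^ 2 + 1) N t2) :=
    (psi_calc d (1 - l) (K + ΛA ^ 2 + 1) N t2 hθ.le hN0).1.continuous
  have hVu : UpperSemicontinuousOn V (Icc 0 T' ×ˢ (closure U ∩ closedBall (0 : Euc d) R)) := by
    have h1 : UpperSemicontinuousOn v' (Icc 0 T' ×ˢ (closure U ∩ closedBall (0 : Euc d) R)) := by
      rw [hv'def]; exact usc_min (hv.mono hDD) hgc
    rw [hVdef]
    have h2 := (usc_mul h1 l (by linarith)).add
      (hpsic.neg.upperSemicontinuous.upperSemicontinuousOn _)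
    intro z hz y hy
    have h3 := h2 z hz y (lt_of_le_of_lt (le_of_eq (sub_eq_add_neg _ _).symm) hy)
    filter_upwards [h3] with z' hz'
    exact lt_of_le_of_lt (le_of_eq (sub_eq_add_neg _ _)) hz'
  have hwl : LowerSemicontinuousOn w' (Icc 0 T' ×ˢ (closure U ∩ closedBall (0 : Euc d) R)) := by
    rw [hw'def]; exact lsc_max (hw.mono hDD) hgc
  obtain ⟨κ, C, hκ, hC, hstr⟩ := H_strict hd hm hΛ haM hH hρ hI hmi hHi hinf (R + 1) (by linarith)
  -- the bracket
  have hbr : ∀ x : Euc d, ‖x‖ ≤ Real.sqrt (1 + ‖x‖ ^ 2) ∧ 1 ≤ Real.sqrt (1 + ‖x‖ ^ 2) := by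
    intro x
    constructor
    · apply Real.le_sqrt_of_sq_le; linarith
    · apply Real.le_sqrt_of_sq_le; nlinarith [sq_nonneg ‖x‖]
  have hbound1 : ∀ t : ℝ, 0 ≤ t → ∀ x : Euc d, v (t, x) - w (t, x) ≤ c →
      V (t, x) - w' (t, x) ≤ c + β := by
    intro t ht x hx
    rw [hVz]
    have e1 := hv'v (t, x)
    have e2 := hw'w (t, x)
    have e3 := hw'g (t, x)
    have e4 : g (t, x) ≤ 1 / 2 * (1 + ‖x‖) + C0 := hg0 (t, x)
    obtain ⟨e5, e6⟩ := hbr x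
    have e7 := Real.exp_pos (N * (t - t2))
    have e8 : 0 ≤ (1 - l) * ((K + ΛA ^ 2 + 1) * t) := by positivity
    have e9 : l * (v' (t, x) - w' (t, x)) ≤ l * c :=
      mul_le_mul_of_nonneg_left (by linarith) (by linarith)
    have e10 : (1 - l) * (- w' (t, x)) ≤ (1 - l) * (Real.sqrt (1 + ‖x‖ ^ 2) + C0) :=
      mul_le_mul_of_nonneg_left (by linarith) hθ.le
    linarith
  have hbound2 : ∀ t : ℝ, 0 ≤ t → ∀ x : Euc d, V (t, x) - w' (t, x) ≤
      (1 - l) / 2 + 2 * C1 - (1 - l) / 2 * ‖x‖ - Real.exp (N * (t - t2)) := by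
    intro t ht x
    rw [hVz]
    have e1 := hv'g (t, x)
    have e3 := hw'g (t, x)
    have e4 : g (t, x) ≤ (1 - l) / 4 * (1 + ‖x‖) + C1 := hg1 (t, x)
    have e0 := hgp (t, x)
    obtain ⟨e5, e6⟩ := hbr x
    have e8 : 0 ≤ (1 - l) * ((K + ΛA ^ 2 + 1) * t) := by positivity
    have e9 : l * v' (t, x) ≤ g (t, x) := by nlinarith
    have e10 : (1 - l) * ‖x‖ ≤ (1 - l) * Real.sqrt (1 + ‖x‖ ^ 2) :=
      mul_le_mul_of_nonneg_left e5 hθ.le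
    linarith
  refine local_comp2 hΛA hA hm hΛ haM hH (by linarith) hKc hKr hU' hUK hVu hwl hκ hC hθ hstr
    hsubV hsup' (b := c + β) (P1 := (t1, x1)) ?_ ?_ ?_
  · rintro ⟨t, x⟩ ⟨ht, hx⟩ hz
    have ht0 : 0 ≤ t := ht.1
    have htT : t ≤ T' := ht.2
    have hpar : t < T → (t = 0 ∨ x ∉ U) → v (t, x) - w (t, x) ≤ c := by
      intro h1 h2
      apply hc
      by_cases hxU : x ∈ U
      · rcases h2 with h2 | h2
        · left
          exact ⟨h2, hxU⟩
        · exact (h2 hxU).elim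
      · right
        refine ⟨⟨ht0, h1⟩, hx.1, ?_⟩
        rwa [hU.interior_eq]
    by_cases h0 : t = 0 ∨ x ∉ U
    · exact hbound1 t ht0 x (hpar (by linarith) h0)
    push Not at h0
    have hb2 := hbound2 t ht0 x
    have hnx := norm_nonneg x
    have hex := Real.exp_pos (N * (t - t2))
    by_cases h1 : t = T'
    · have e1 : N * (t - t2) = N * ((T' - t1) / 2) := by rw [h1, ht2]; ring
      rw [e1] at hb2
      have : 0 ≤ (1 - l) / 2 * ‖x‖ := by positivity
      linarith
    · have h2 : R ≤ ‖x‖ := by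
        by_contra h3
        push Not at h3
        exact hz ⟨⟨lt_of_le_of_ne ht0 (Ne.symm h0.1), lt_of_le_of_ne htT h1⟩, h0.2, by simpa using h3⟩
      have : (1 - l) / 2 * R ≤ (1 - l) / 2 * ‖x‖ :=
        mul_le_mul_of_nonneg_left h2 (by linarith)
      linarith
  · exact ⟨⟨ht1.1.le, hT1.le⟩, subset_closure hx1, by simpa using hR1.le⟩
  · rw [hVz, hv'e t1 ⟨ht1.1.le, ht1.2.le⟩ x1 hx1, hw'e t1 ⟨ht1.1.le, ht1.2.le⟩ x1 hx1]
    have e1 : N * (t1 - t2) = N * (-((T' - t1) / 2)) := by rw [ht2]; ring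
    rw [e1]
    linarith
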